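/- Let q ∈ ℕ₀. For each λ ∈ [0,2) there is a constant c > 0 depending only on q and λ such that for each n ∈ ℕ there exists a positive linear operator M_n : C[0,1] → Π_n preserving k-monotonicity for every 0 ≤ k ≤ q, and such that for every f ∈ C[0,1] and every x ∈ [0,1]: |f(x) − M_n(f,x)| ≤ c ω₂^{φ^λ}(f, n^{−1} φ^{1−λ/2}(x) (φ(x) + 1/n)^{−λ/2}). In particular, for λ = 0 one has |f(x) − M_n(f,x)| ≤ c ω₂(f, √(x(1−x))/n), and for λ = 1 one has |f(x) − M_n(f,x)| ≤ c ω₂^φ(f, n^{−1} √(φ(x)/(φ(x)+1/n))) ≤ c ω₂^φ(f, 1/n). -/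

import Mathlib

noncomputable section

open Set Finset
open scoped Classical

/-- The interval `[0,1]`. -/
def I01 : Set ℝ := Set.Icc 0 1

/-- `φ(x) = √(x(1-x))`. -/
def phi (x : ℝ) : ℝ := Real.sqrt (x * (1 - x))

/-- The `k`-th symmetric difference of `f` with step `δ`. -/
def centralDiff (k : ℕ) (δ : ℝ) (f : ℝ → ℝ) (x : ℝ) : ℝ :=
  if (x - k * δ / 2) ∈ I01 ∧ (x + k * δ / 2) ∈ I01 then
    ∑ i ∈ Finset.range (k + 1),
      (k.choose i : ℝ) * (-1 : ℝ) ^ (k - i) * f (x - k * δ / 2 + i * δ)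
  else 0

/-- The second Ditzian–Totik modulus of smoothness with step-weight `ψ`. -/
def omega2 (ψ : ℝ → ℝ) (f : ℝ → ℝ) (t : ℝ) : ℝ :=
  sSup {v : ℝ | ∃ s x : ℝ, 0 < s ∧ s ≤ t ∧ x ∈ I01 ∧ v = |centralDiff 2 (s * ψ x) f x|}

/-- `f` is `k`-monotone on `[0,1]`. -/
def kMono (k : ℕ) (f : ℝ → ℝ) : Prop :=
  ∀ δ : ℝ, 0 < δ → ∀ x ∈ I01, 0 ≤ centralDiff k δ f x

/-- `g` coincides (on all of `ℝ`) with an algebraic polynomial of degree at most `n`. -/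
def IsPolyOfDegLe (n : ℕ) (g : ℝ → ℝ) : Prop :=
  ∃ p : Polynomial ℝ, p.natDegree ≤ n ∧ ∀ x, g x = p.eval x

/-- `L` is a positive linear operator `C[0,1] → C[0,1]`. -/
def PositiveLinearOp (L : (ℝ → ℝ) → (ℝ → ℝ)) : Prop :=
  (∀ f g : ℝ → ℝ, ContinuousOn f I01 → ContinuousOn g I01 →
      ∀ x ∈ I01, L (fun y => f y + g y) x = L f x + L g x) ∧
  (∀ (a : ℝ) (f : ℝ → ℝ), ContinuousOn f I01 →
      ∀ x ∈ I01, L (fun y => a * f y) x = a * L f x) ∧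
  (∀ f : ℝ → ℝ, ContinuousOn f I01 → ContinuousOn (L f) I01) ∧
  (∀ f : ℝ → ℝ, ContinuousOn f I01 → (∀ x ∈ I01, 0 ≤ f x) → ∀ x ∈ I01, 0 ≤ L f x)

section Kernel
open Polynomial

/-- The antiderivative of a polynomial that vanishes at `0`. -/
def antideriv (p : ℝ[X]) : ℝ[X] := p.sum fun i a => monomial (i + 1) (a / (i + 1))

lemma derivative_antideriv (p : ℝ[X]) : derivative (antideriv p) = p := by
  have : ∀ i : ℕ, ((i : ℝ) + 1) ≠ 0 := fun i => by positivity
  simp only [antideriv, Polynomial.sum, derivative_sum, derivative_monomial]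
  conv_rhs => rw [p.as_sum_support]
  refine Finset.sum_congr rfl fun i _ => ?_
  congr 1
  push_cast
  field_simp

lemma coeff_zero_antideriv (p : ℝ[X]) : (antideriv p).coeff 0 = 0 := by
  simp [antideriv, Polynomial.sum, coeff_monomial]

lemma eval_zero_antideriv (p : ℝ[X]) : (antideriv p).eval 0 = 0 := by
  rw [← coeff_zero_eq_eval_zero, coeff_zero_antideriv]

lemma natDegree_antideriv_le (p : ℝ[X]) : (antideriv p).natDegree ≤ p.natDegree + 1 := by
  refine natDegree_sum_le_of_forall_le _ _ fun i hi => ?_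
  exact (natDegree_monomial_le _).trans (by have := le_natDegree_of_mem_supp i hi; omega)

lemma natDegree_iterate_antideriv_le (p : ℝ[X]) (i : ℕ) :
    (antideriv^[i] p).natDegree ≤ p.natDegree + i := by
  induction i with
  | zero => simp
  | succ i ih =>
    rw [Function.iterate_succ_apply']
    exact (natDegree_antideriv_le _).trans (by omega)

lemma iterate_derivative_iterate_antideriv (p : ℝ[X]) (i j : ℕ) :
    derivative^[j] (antideriv^[j + i] p) = antideriv^[i] p := by
  induction j with
  | zero => simp
  | succ j ih =>
    rw [show j + 1 + i = (j + i) + 1 by ring, Function.iterate_succ_apply' antideriv,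
      Function.iterate_succ_apply, derivative_antideriv, ih]

/-- Comparison of an antiderivative with a differentiable function. -/
lemma antideriv_comparison (p : ℝ[X]) (g g' : ℝ → ℝ) (a b : ℝ)
    (hg : ∀ s ∈ Icc a b, HasDerivAt g (g' s) s) (ha : (antideriv p).eval a ≤ g a)
    (hle : ∀ s ∈ Icc a b, p.eval s ≤ g' s) :
    ∀ s ∈ Icc a b, (antideriv p).eval s ≤ g s := by
  intro s hs
  have hd : ∀ u ∈ Icc a b, HasDerivAt (fun v => g v - (antideriv p).eval v)
      (g' u - p.eval u) u := by
    intro u hu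
    have h2 := (antideriv p).hasDerivAt u
    rw [derivative_antideriv] at h2
    exact (hg u hu).sub h2
  have hm : MonotoneOn (fun v => g v - (antideriv p).eval v) (Icc a b) := by
    refine monotoneOn_of_hasDerivWithinAt_nonneg (f' := fun u => g' u - p.eval u) (convex_Icc a b)
      (fun u hu => (hd u hu).continuousAt.continuousWithinAt) ?_ ?_
    · intro u hu
      exact (hd u (interior_subset hu)).hasDerivWithinAt
    · intro u hu
      have := hle u (interior_subset hu)
      linarith
  have := hm (left_mem_Icc.2 (hs.1.trans hs.2)) hs hs.1
  simp only at this
  linarith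

lemma le_antideriv_comparison (p : ℝ[X]) (g g' : ℝ → ℝ) (a b : ℝ)
    (hg : ∀ s ∈ Icc a b, HasDerivAt g (g' s) s) (ha : g a ≤ (antideriv p).eval a)
    (hle : ∀ s ∈ Icc a b, g' s ≤ p.eval s) :
    ∀ s ∈ Icc a b, g s ≤ (antideriv p).eval s := by
  intro s hs
  have hd : ∀ u ∈ Icc a b, HasDerivAt (fun v => (antideriv p).eval v - g v)
      (p.eval u - g' u) u := by
    intro u hu
    have h2 := (antideriv p).hasDerivAt u
    rw [derivative_antideriv] at h2
    exact h2.sub (hg u hu)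
  have hm : MonotoneOn (fun v => (antideriv p).eval v - g v) (Icc a b) := by
    refine monotoneOn_of_hasDerivWithinAt_nonneg (f' := fun u => p.eval u - g' u) (convex_Icc a b)
      (fun u hu => (hd u hu).continuousAt.continuousWithinAt) ?_ ?_
    · intro u hu
      exact (hd u (interior_subset hu)).hasDerivWithinAt
    · intro u hu
      have := hle u (interior_subset hu)
      linarith
  have := hm (left_mem_Icc.2 (hs.1.trans hs.2)) hs hs.1
  simp only at this
  linarith

lemma iterate_antideriv_nonneg (p : ℝ[X]) (hp : ∀ s ∈ Icc (0 : ℝ) 1, 0 ≤ p.eval s) (i : ℕ) :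
    ∀ s ∈ Icc (0 : ℝ) 1, 0 ≤ (antideriv^[i] p).eval s := by
  induction i with
  | zero => simpa using hp
  | succ i ih =>
    rw [Function.iterate_succ_apply']
    exact le_antideriv_comparison _ (fun _ => 0) (fun _ => 0) 0 1
      (fun s _ => hasDerivAt_const s (0 : ℝ)) (eval_zero_antideriv _).ge ih

lemma hasDerivAt_pow_div (a : ℝ) (ha : 0 ≤ a) (e : ℕ) (s : ℝ) (hs : s ≤ 1) :
    HasDerivAt (fun s : ℝ => (a / (1 + a * (1 - s))) ^ e)
      (e * (a / (1 + a * (1 - s))) ^ (e + 1)) s := by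
  have hpos : 0 < 1 + a * (1 - s) := by
    have := mul_nonneg ha (sub_nonneg.2 hs); linarith
  have h1 : HasDerivAt (fun s : ℝ => 1 + a * (1 - s)) (-a) s := by
    have := (((hasDerivAt_id s).const_sub 1).const_mul a).const_add 1
    simpa using this
  have h2 := ((hasDerivAt_const s a).div h1 hpos.ne').pow e
  refine h2.congr_deriv ?_
  rcases e with _ | e
  · simp
  · simp only [Nat.add_sub_cancel]
    push_cast
    have : (1 + a * (1 - s)) ≠ 0 := hpos.ne'
    simp only [Pi.div_apply]
    generalize 1 + a * (1 - s) = v at this ⊢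
    rw [div_pow, div_pow]
    field_simp
    ring

lemma iterate_antideriv_le (p : ℝ[X]) (a K : ℝ) (ha : 0 ≤ a) (hK : 0 ≤ K) (e : ℕ)
    (hp : ∀ s ∈ Icc (0 : ℝ) 1, p.eval s ≤ K * (a / (1 + a * (1 - s))) ^ (e + 1)) (i : ℕ)
    (hi : i ≤ e) : ∀ s ∈ Icc (0 : ℝ) 1,
      (antideriv^[i] p).eval s ≤ K * (a / (1 + a * (1 - s))) ^ (e - i + 1) := by
  induction i with
  | zero => simpa using hp
  | succ i ih =>
    rw [Function.iterate_succ_apply']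
    obtain ⟨d, rfl⟩ : ∃ d, e = i + 1 + d := ⟨e - (i + 1), by omega⟩
    have h := ih (by omega)
    rw [show i + 1 + d - i + 1 = d + 2 by omega] at h
    rw [show i + 1 + d - (i + 1) + 1 = d + 1 by omega]
    refine antideriv_comparison _ (fun s => K * (a / (1 + a * (1 - s))) ^ (d + 1))
      (fun s => K * ((d + 1 : ℕ) * (a / (1 + a * (1 - s))) ^ (d + 2))) 0 1 ?_ ?_ ?_
    · intro s hs
      exact (hasDerivAt_pow_div a ha (d + 1) s hs.2).const_mul K
    · rw [eval_zero_antideriv]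
      positivity
    · intro s hs
      refine (h s hs).trans (mul_le_mul_of_nonneg_left ?_ hK)
      have : 0 ≤ (a / (1 + a * (1 - s))) ^ (d + 2) := by
        have := mul_nonneg ha (sub_nonneg.2 hs.2); positivity
      have h1 : (1 : ℝ) ≤ ((d + 1 : ℕ) : ℝ) := by exact_mod_cast Nat.succ_le_succ (Nat.zero_le d)
      nlinarith

lemma le_iterate_antideriv (p : ℝ[X]) (b s₀ : ℝ) (h₀ : 0 ≤ s₀)
    (hp : ∀ s ∈ Icc (0 : ℝ) 1, 0 ≤ p.eval s)
    (hb : ∀ s ∈ Icc s₀ 1, b ≤ p.eval s) (i : ℕ) : ∀ s ∈ Icc s₀ 1,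
      b * (s - s₀) ^ i / (i.factorial : ℝ) ≤ (antideriv^[i] p).eval s := by
  induction i with
  | zero => simpa using hb
  | succ i ih =>
    by_cases hs1 : s₀ ≤ 1
    swap
    · intro s hs; exact absurd (hs.1.trans hs.2) hs1
    have hn := iterate_antideriv_nonneg p hp (i + 1) s₀ ⟨h₀, hs1⟩
    rw [Function.iterate_succ_apply'] at hn ⊢
    refine le_antideriv_comparison _ (fun s => b * (s - s₀) ^ (i + 1) / ((i + 1).factorial : ℝ))
      (fun s => b * (s - s₀) ^ i / (i.factorial : ℝ)) s₀ 1 ?_ ?_ ih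
    · intro s _
      have := ((((hasDerivAt_id s).sub_const s₀).pow (i + 1)).const_mul b).div_const
        ((i + 1).factorial : ℝ)
      refine this.congr_deriv ?_
      have : ((i.factorial : ℕ) : ℝ) ≠ 0 := by positivity
      rw [Nat.factorial_succ]
      push_cast
      simp
      field_simp
    · simpa using hn

lemma abs_eval_U_le (m : ℕ) (θ : ℝ) :
    |(Chebyshev.U ℝ m).eval (Real.cos θ)| ≤ m + 1 := by
  induction m with
  | zero => simp
  | succ m ih =>
    have h1 : (Chebyshev.U ℝ ((m + 1 : ℕ) : ℤ)) = X * Chebyshev.U ℝ m + Chebyshev.T ℝ (m + 1) := by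
      push_cast; exact Chebyshev.U_eq_X_mul_U_add_T ℝ m
    rw [h1, eval_add, eval_mul, eval_X, Chebyshev.T_real_cos]
    refine (abs_add_le _ _).trans ?_
    rw [abs_mul]
    have h2 := Real.abs_cos_le_one θ
    have h3 := Real.abs_cos_le_one (((m : ℤ) + 1 : ℤ) * θ)
    push_cast
    push_cast at h3
    nlinarith [abs_nonneg ((Chebyshev.U ℝ m).eval (Real.cos θ)), abs_nonneg (Real.cos θ)]

lemma eval_U_sq_le (m : ℕ) (s : ℝ) (hs : s ∈ Icc (0 : ℝ) 1) :
    ((Chebyshev.U ℝ m).eval s) ^ 2 ≤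
      2 * (((m : ℝ) + 1) ^ 2 / (1 + ((m : ℝ) + 1) ^ 2 * (1 - s))) := by
  obtain ⟨h0, h1⟩ := hs
  have hc : Real.cos (Real.arccos s) = s := Real.cos_arccos (by linarith) h1
  have hU := abs_eval_U_le m (Real.arccos s)
  have hS := Chebyshev.U_real_cos (Real.arccos s) m
  have hsin := Real.sin_sq_add_cos_sq (Real.arccos s)
  rw [hc] at hU hS hsin
  set u := (Chebyshev.U ℝ m).eval s
  have e1 : u ^ 2 ≤ ((m : ℝ) + 1) ^ 2 :=
    sq_le_sq' (by linarith [neg_abs_le u]) ((le_abs_self u).trans hU)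
  have e2 : u ^ 2 * (1 - s ^ 2) ≤ 1 := by
    have : u ^ 2 * (1 - s ^ 2) = (u * Real.sin (Real.arccos s)) ^ 2 := by
      rw [mul_pow]; linear_combination (-u ^ 2) * hsin
    rw [this, hS]
    exact Real.sin_sq_le_one _
  have e3 : u ^ 2 * (1 - s) ≤ 1 := by
    nlinarith [mul_nonneg (mul_nonneg (sq_nonneg u) (sub_nonneg.2 h1)) h0]
  have hpos : 0 < 1 + ((m : ℝ) + 1) ^ 2 * (1 - s) := by
    have := mul_nonneg (sq_nonneg ((m : ℝ) + 1)) (sub_nonneg.2 h1); linarith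
  rw [← mul_div_assoc, le_div_iff₀ hpos]
  nlinarith [sq_nonneg ((m : ℝ) + 1)]

lemma le_eval_U (m : ℕ) (s : ℝ) (hs : s ∈ Set.Icc (1 - 1 / (2 * ((m : ℝ) + 1) ^ 2)) 1) :
    2 / Real.pi * ((m : ℝ) + 1) ≤ (Chebyshev.U ℝ m).eval s := by
  obtain ⟨h0, h1⟩ := hs
  have hm : (1 : ℝ) ≤ (m : ℝ) + 1 := by linarith [Nat.cast_nonneg (α := ℝ) m]
  have hq : 1 / (2 * ((m : ℝ) + 1) ^ 2) ≤ 1 := by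
    rw [div_le_one (by positivity)]; nlinarith
  have hc : Real.cos (Real.arccos s) = s := Real.cos_arccos (by linarith) h1
  have hS := Chebyshev.U_real_cos (Real.arccos s) m
  rw [hc] at hS
  have hpi := Real.pi_pos
  rcases eq_or_lt_of_le (Real.arccos_nonneg s) with hθ | hθ
  · have : s = 1 := by rw [← hc, ← hθ, Real.cos_zero]
    rw [this, Chebyshev.U_eval_one]
    have : 2 / Real.pi ≤ 1 := by rw [div_le_one hpi]; linarith [Real.pi_gt_three]
    push_cast
    nlinarith
  · have hcos := Real.cos_le_one_sub_mul_cos_sq (x := Real.arccos s)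
      (by rw [abs_of_pos hθ]; exact Real.arccos_le_pi s)
    rw [hc] at hcos
    set θ := Real.arccos s
    have hθ2 : (((m : ℝ) + 1) * θ) ^ 2 ≤ (Real.pi / 2) ^ 2 := by
      have h3 : 2 / Real.pi ^ 2 * θ ^ 2 ≤ 1 / (2 * ((m : ℝ) + 1) ^ 2) := by linarith
      rw [le_div_iff₀ (by positivity), div_mul_eq_mul_div, div_mul_eq_mul_div,
        div_le_iff₀ (by positivity)] at h3
      nlinarith
    have hθ3 : ((m : ℝ) + 1) * θ ≤ Real.pi / 2 := by
      exact (le_abs_self _).trans (abs_le_of_sq_le_sq hθ2 (by positivity))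
    have h4 := Real.mul_le_sin (by positivity) hθ3
    have hsθ : 0 < Real.sin θ := by
      refine Real.sin_pos_of_pos_of_lt_pi hθ ?_
      nlinarith
    have h5 : Real.sin θ ≤ θ := Real.sin_le hθ.le
    push_cast at hS
    have h6 : 2 / Real.pi * ((m : ℝ) + 1) * Real.sin θ ≤ (Chebyshev.U ℝ m).eval s * Real.sin θ := by
      rw [hS]
      refine le_trans ?_ h4
      rw [mul_assoc]
      gcongr
    exact le_of_mul_le_mul_right h6 hsθ

/-- Polynomials of degree at most `n` that are absolutely monotone up to a given order, normalised
at `1`, and have integral `O(n⁻²)`. -/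
lemma exists_absolutelyMonotone_polynomial (r : ℕ) :
    ∃ K : ℝ, 0 < K ∧ ∀ n : ℕ, 1 ≤ n → ∃ H : ℝ[X], H.natDegree ≤ n ∧ H.coeff 0 = 0 ∧
      H.eval 1 = 1 ∧ (∀ j ≤ r + 1, ∀ w ∈ Set.Icc (0 : ℝ) 1, 0 ≤ (derivative^[j] H).eval w) ∧
      (antideriv H).eval 1 ≤ K / (n : ℝ) ^ 2 := by
  -- with `R = r + 1` antiderivatives, the kernel is the `2 (R + 2)`-th power of `U m`
  set R := r + 1 with hR
  set κ : ℝ := (2 / Real.pi) ^ (2 * (R + 2)) * (1 / 2) ^ R / (R.factorial : ℝ) with hκ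
  have hκ0 : 0 < κ := by positivity
  set K₁ : ℝ := 2 ^ (R + 2) / κ * (4 * (R + 2)) ^ 2 with hK₁
  refine ⟨max K₁ ((2 * R : ℕ) ^ 2), lt_of_lt_of_le (by positivity) (le_max_left _ _), ?_⟩
  intro n hn
  have hn0 : (0 : ℝ) < n := by exact_mod_cast hn
  rcases lt_or_ge n (2 * R) with hlt | hge
  · refine ⟨X, natDegree_X_le.trans hn, by simp, by simp, ?_, ?_⟩
    · intro j _ w hw
      rcases j with _ | _ | j
      · simpa using hw.1
      · simp
      · rw [Function.iterate_succ_apply, Function.iterate_succ_apply, derivative_X]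
        simp
    · have h1 : (antideriv (X : ℝ[X])).eval 1 ≤ 1 := by
        have := antideriv_comparison (X : ℝ[X]) (fun s => s) (fun _ => 1) 0 1
          (fun s _ => hasDerivAt_id s) (eval_zero_antideriv _).le (fun s hs => by simpa using hs.2)
          1 ⟨zero_le_one, le_rfl⟩
        simpa using this
      refine h1.trans ?_
      rw [le_div_iff₀ (by positivity), one_mul]
      refine le_trans ?_ (le_max_right _ _)
      have : (n : ℝ) ≤ (2 * R : ℕ) := by exact_mod_cast hlt.le
      gcongr
  · set m := (n - R) / (2 * (R + 2)) with hm
    set J : ℝ[X] := (Chebyshev.U ℝ m) ^ (2 * (R + 2)) with hJ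
    set a : ℝ := ((m : ℝ) + 1) ^ 2 with ha
    have ha0 : 0 < a := by positivity
    have hJdeg : J.natDegree ≤ 2 * (R + 2) * m := by
      refine natDegree_pow_le.trans (Nat.mul_le_mul_left _ ?_)
      have := Chebyshev.natDegree_U_natCast ℝ m
      exact this.le
    have hmn : 2 * (R + 2) * m ≤ n - R := Nat.mul_div_le _ _
    have hJ0 : ∀ s ∈ Set.Icc (0 : ℝ) 1, 0 ≤ J.eval s := by
      intro s _
      rw [hJ, eval_pow, pow_mul]
      positivity
    have hJle : ∀ s ∈ Set.Icc (0 : ℝ) 1,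
        J.eval s ≤ 2 ^ (R + 2) * (a / (1 + a * (1 - s))) ^ (R + 1 + 1) := by
      intro s hs
      rw [hJ, eval_pow, pow_mul, show R + 1 + 1 = R + 2 from rfl, ← mul_pow]
      exact pow_le_pow_left₀ (sq_nonneg _) (eval_U_sq_le m s hs) _
    have hup := iterate_antideriv_le J a _ ha0.le (by positivity) (R + 1) hJle (R + 1) le_rfl 1
      ⟨zero_le_one, le_rfl⟩
    have ha1 : 1 ≤ a := by
      have : (0 : ℝ) ≤ m := Nat.cast_nonneg m
      nlinarith
    have hs0 : 0 ≤ 1 - 1 / (2 * a) := by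
      rw [sub_nonneg, div_le_one (by positivity)]; linarith
    have hs1 : 1 - 1 / (2 * a) ≤ 1 := by
      have : 0 ≤ 1 / (2 * a) := by positivity
      linarith
    have hlow := le_iterate_antideriv J ((2 / Real.pi * ((m : ℝ) + 1)) ^ (2 * (R + 2)))
      (1 - 1 / (2 * a)) hs0 hJ0 (fun s hs => by
        rw [hJ, eval_pow]
        exact pow_le_pow_left₀ (by positivity) (le_eval_U m s hs) _) R 1 ⟨hs1, le_rfl⟩
    have hlow' : κ * a ^ 2 ≤ (antideriv^[R] J).eval 1 := by
      refine le_trans (le_of_eq ?_) hlow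
      rw [hκ, mul_pow, pow_mul ((m : ℝ) + 1), ← ha, pow_add a R 2,
        show (1 - (1 - 1 / (2 * a))) = 1 / 2 * (1 / a) by field_simp; ring, mul_pow, one_div_pow a]
      field_simp
    set D := (antideriv^[R] J).eval 1 with hD
    have hD0 : 0 < D := lt_of_lt_of_le (by positivity) hlow'
    have hC : antideriv (C D⁻¹ * antideriv^[R] J) = C D⁻¹ * antideriv^[R + 1] J := by
      have h1 : derivative (antideriv (C D⁻¹ * antideriv^[R] J) -
          C D⁻¹ * antideriv^[R + 1] J) = 0 := by
        rw [derivative_sub, derivative_antideriv, derivative_C_mul,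
          Function.iterate_succ_apply' antideriv R, derivative_antideriv, sub_self]
      have h2 := derivative_eq_zero.1 h1
      rw [natDegree_eq_zero] at h2
      obtain ⟨y, hy⟩ := h2
      have h3 := congrArg (eval 0) hy
      rw [eval_sub, eval_mul, eval_zero_antideriv, Function.iterate_succ_apply',
        eval_zero_antideriv] at h3
      simp only [eval_C, mul_zero, sub_zero] at h3
      rw [h3, C_0] at hy
      exact (sub_eq_zero.1 hy.symm)
    refine ⟨C D⁻¹ * antideriv^[R] J, ?_, ?_, ?_, ?_, ?_⟩
    · refine (natDegree_C_mul_le _ _).trans ((natDegree_iterate_antideriv_le _ _).trans ?_)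
      omega
    · rw [coeff_C_mul, hR, Function.iterate_succ_apply', coeff_zero_antideriv, mul_zero]
    · rw [eval_mul, eval_C, ← hD, inv_mul_cancel₀ hD0.ne']
    · intro j hj w hw
      obtain ⟨i, hi⟩ : ∃ i, R = j + i := ⟨R - j, by omega⟩
      rw [iterate_derivative_C_mul, eval_mul, eval_C, hi, iterate_derivative_iterate_antideriv]
      exact mul_nonneg (inv_nonneg.2 hD0.le) (iterate_antideriv_nonneg J hJ0 i w hw)
    · rw [hC, eval_mul, eval_C]
      simp only [sub_self, mul_zero, add_zero, div_one, Nat.sub_self, zero_add, pow_one] at hup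
      have hna : (n : ℝ) ^ 2 ≤ (4 * (R + 2)) ^ 2 * a := by
        rw [ha, ← mul_pow]
        have h1 : n - R < 2 * (R + 2) * (m + 1) := by
          rw [mul_comm]; exact Nat.lt_mul_of_div_lt (Nat.lt_succ_self _) (by positivity)
        have h2 : n ≤ 4 * (R + 2) * (m + 1) := by
          have : 4 * (R + 2) * (m + 1) = 2 * (2 * (R + 2) * (m + 1)) := by ring
          omega
        have h3 : (n : ℝ) ≤ 4 * (R + 2) * (m + 1) := by exact_mod_cast h2
        gcongr
      have h4 : D⁻¹ * (antideriv^[R + 1] J).eval 1 ≤ 2 ^ (R + 2) / κ / a := by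
        rw [inv_mul_le_iff₀ hD0]
        refine hup.trans ?_
        have h5 : 2 ^ (R + 2) * a = κ * a ^ 2 * (2 ^ (R + 2) / κ / a) := by
          field_simp
        rw [h5]
        gcongr
      refine h4.trans (le_trans ?_ (div_le_div_of_nonneg_right (le_max_left _ _) (by positivity)))
      rw [hK₁, div_le_div_iff₀ ha0 (by positivity), mul_assoc]
      gcongr
end Kernel

section Ultraspherical
open Polynomial

/-- The moments of the cosine with respect to the weight `sin ^ (2 i)`. -/
def cosMoment (i e : ℕ) : ℝ := ∫ θ in (0 : ℝ)..Real.pi, Real.cos θ ^ e * Real.sin θ ^ (2 * i)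

lemma cosMoment_zero_pos (i : ℕ) : 0 < cosMoment i 0 := by
  have := integral_sin_pow_pos (2 * i)
  simpa [cosMoment] using this

lemma cosMoment_one (i : ℕ) : cosMoment i 1 = 0 := by
  have h : ∀ θ ∈ Set.uIcc (0 : ℝ) Real.pi, HasDerivAt
      (fun θ => Real.sin θ ^ (2 * i + 1) / (2 * i + 1 : ℝ))
      (Real.cos θ ^ 1 * Real.sin θ ^ (2 * i)) θ := by
    intro θ _
    have := ((Real.hasDerivAt_sin θ).pow (2 * i + 1)).div_const (2 * i + 1 : ℝ)
    refine this.congr_deriv ?_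
    have : (2 * i + 1 : ℝ) ≠ 0 := by positivity
    push_cast
    simp
    field_simp
  rw [cosMoment, intervalIntegral.integral_eq_sub_of_hasDerivAt h
    (Continuous.intervalIntegrable (by fun_prop) _ _)]
  simp

lemma cosMoment_add_two (i e : ℕ) :
    (2 * i + e + 2 : ℝ) * cosMoment i (e + 2) = (e + 1) * cosMoment i e := by
  have h : ∀ θ ∈ Set.uIcc (0 : ℝ) Real.pi, HasDerivAt
      (fun θ => Real.cos θ ^ (e + 1) * Real.sin θ ^ (2 * i + 1))
      ((2 * i + e + 2 : ℝ) * (Real.cos θ ^ (e + 2) * Real.sin θ ^ (2 * i)) -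
        (e + 1) * (Real.cos θ ^ e * Real.sin θ ^ (2 * i))) θ := by
    intro θ _
    have := ((Real.hasDerivAt_cos θ).pow (e + 1)).mul ((Real.hasDerivAt_sin θ).pow (2 * i + 1))
    refine this.congr_deriv ?_
    have hs : Real.sin θ * Real.sin θ = 1 - Real.cos θ ^ 2 := by
      rw [← Real.sin_sq θ, sq]
    push_cast
    simp only [Pi.pow_apply]
    have : Real.sin θ ^ (2 * i + 1) * Real.sin θ = (1 - Real.cos θ ^ 2) * Real.sin θ ^ (2 * i) := by
      rw [← hs]; ring
    linear_combination (-(e + 1) * Real.cos θ ^ e) * this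
  have h2 := intervalIntegral.integral_eq_sub_of_hasDerivAt h
    (Continuous.intervalIntegrable (by fun_prop) _ _)
  rw [intervalIntegral.integral_sub (Continuous.intervalIntegrable (by fun_prop) _ _)
    (Continuous.intervalIntegrable (by fun_prop) _ _), intervalIntegral.integral_const_mul,
    intervalIntegral.integral_const_mul] at h2
  simp only [Real.sin_pi, Real.sin_zero, ne_eq, Nat.add_eq_zero_iff, one_ne_zero, and_false,
    not_false_eq_true, zero_pow, mul_zero, sub_self] at h2
  simp only [cosMoment]
  linarith

lemma cosMoment_odd (i d : ℕ) : cosMoment i (2 * d + 1) = 0 := by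
  induction d with
  | zero => exact cosMoment_one i
  | succ d ih =>
    have := cosMoment_add_two i (2 * d + 1)
    rw [ih, mul_zero] at this
    rcases mul_eq_zero.1 this with h | h
    · push_cast at h
      have : (0 : ℝ) < 2 * i + (2 * d + 1) + 2 := by positivity
      linarith
    · exact h

lemma cosMoment_even (i d : ℕ) : cosMoment i (2 * d) =
    cosMoment i 0 * (((2 * d).factorial : ℝ) * i.factorial /
      (4 ^ d * d.factorial * (d + i).factorial)) := by
  induction d with
  | zero =>
    have : ((i.factorial : ℕ) : ℝ) ≠ 0 := by positivity
    simp; field_simp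
  | succ d ih =>
    have h := cosMoment_add_two i (2 * d)
    rw [ih] at h
    have h1 : (2 * i + (2 * d : ℕ) + 2 : ℝ) ≠ 0 := by positivity
    rw [show 2 * (d + 1) = 2 * d + 2 by ring]
    refine mul_left_cancel₀ h1 (h.trans ?_)
    rw [show 2 * d + 2 = (2 * d + 1) + 1 by ring, Nat.factorial_succ (2 * d + 1),
      Nat.factorial_succ (2 * d), Nat.factorial_succ d, show d + 1 + i = (d + i) + 1 by ring,
      Nat.factorial_succ (d + i)]
    push_cast
    field_simp
    ring

lemma sum_range_even (N : ℕ) (g : ℕ → ℝ) (hg : ∀ d, g (2 * d + 1) = 0) :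
    ∑ e ∈ range (N + 1), g e = ∑ d ∈ range (N + 1), if 2 * d ≤ N then g (2 * d) else 0 := by
  rw [← Finset.sum_filter]
  have h1 : ∑ e ∈ range (N + 1), g e = ∑ e ∈ (range (N + 1)).filter (fun e => e % 2 = 0), g e := by
    rw [Finset.sum_filter]
    refine Finset.sum_congr rfl fun e _ => ?_
    split_ifs with h
    · rfl
    · rw [show e = 2 * (e / 2) + 1 by omega, hg]
  rw [h1]
  refine Finset.sum_nbij' (fun e => e / 2) (fun d => 2 * d) ?_ ?_ ?_ ?_ ?_
  · intro e he
    simp only [Finset.mem_filter, Finset.mem_range] at he ⊢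
    omega
  · intro e he
    simp only [Finset.mem_filter, Finset.mem_range] at he ⊢
    omega
  · intro e he
    simp only [Finset.mem_filter, Finset.mem_range] at he ⊢
    omega
  · intro e _
    omega
  · intro e he
    simp only [Finset.mem_filter, Finset.mem_range] at he ⊢
    congr 1
    omega

/-- Vandermonde's identity in terms of factorials. -/
lemma vandermonde_factorial (k l i : ℕ) :
    ((k + l + i).factorial : ℝ) / (k.factorial * (k + i).factorial * (l.factorial *
      (l + i).factorial)) = ∑ d ∈ range (k + l + 1), if d ≤ k ∧ d ≤ l then
      (1 : ℝ) / ((k - d).factorial * (l - d).factorial * (d.factorial * (d + i).factorial))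
      else 0 := by
  have h1 : ((k + (l + i)).choose l : ℝ) =
      ∑ d ∈ range (l + 1), (k.choose d : ℝ) * ((l + i).choose (l - d) : ℝ) := by
    rw [Nat.add_choose_eq, Finset.Nat.sum_antidiagonal_eq_sum_range_succ
      (fun a b => k.choose a * (l + i).choose b)]
    push_cast
    rfl
  have h2 : ((k + l + i).factorial : ℝ) =
      (k + (l + i)).choose l * l.factorial * (k + i).factorial := by
    have := Nat.choose_mul_factorial_mul_factorial (show l ≤ k + (l + i) by omega)
    rw [show k + (l + i) - l = k + i by omega, show k + (l + i) = k + l + i by omega] at this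
    rw [show k + (l + i) = k + l + i by omega]
    exact_mod_cast this.symm
  have h3 : ∑ d ∈ range (k + l + 1), (if d ≤ k ∧ d ≤ l then
      (1 : ℝ) / ((k - d).factorial * (l - d).factorial * (d.factorial * (d + i).factorial))
      else 0) = ∑ d ∈ range (l + 1), (if d ≤ k ∧ d ≤ l then
      (1 : ℝ) / ((k - d).factorial * (l - d).factorial * (d.factorial * (d + i).factorial))
      else 0) := by
    symm
    refine Finset.sum_subset (Finset.range_mono (by omega)) fun d _ hd => ?_
    rw [Finset.mem_range] at hd
    rw [if_neg (by omega)]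
  rw [h3, h2, h1, Finset.sum_mul, Finset.sum_mul, Finset.sum_div]
  refine Finset.sum_congr rfl fun d hd => ?_
  rw [Finset.mem_range] at hd
  by_cases hk : d ≤ k
  · rw [if_pos ⟨hk, by omega⟩, Nat.cast_choose ℝ hk, Nat.cast_choose ℝ (by omega : l - d ≤ l + i),
      show l + i - (l - d) = d + i by omega]
    field_simp
  · rw [if_neg (by omega), Nat.choose_eq_zero_of_lt (by omega)]
    simp

/-- The homogeneous polynomials whose positive combinations give the kernels of
Bernstein-Durrmeyer type operators and of their derivatives. -/
def ultrasphericalSum (i N : ℕ) (A B : ℝ) : ℝ :=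
  ∑ k ∈ range (N + 1), (N.choose k : ℝ) * ((N + 2 * i).choose (k + i) : ℝ) * A ^ k * B ^ (N - k)

lemma sum_shift (N d : ℕ) (hd : 2 * d ≤ N) (g : ℕ → ℝ) :
    ∑ k ∈ range (N + 1), (if d ≤ k ∧ d ≤ N - k then g k else 0) =
      ∑ p ∈ range (N - 2 * d + 1), g (p + d) := by
  rw [← Finset.sum_filter]
  refine Finset.sum_nbij' (fun e => e - d) (fun p => p + d) ?_ ?_ ?_ ?_ ?_
  all_goals intro e he
  all_goals simp only [Finset.mem_filter, Finset.mem_range] at he ⊢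
  all_goals try omega
  congr 1
  omega

lemma ultrasphericalSum_eq (i N : ℕ) (A B : ℝ) :
    ultrasphericalSum i N A B / ((N + 2 * i).choose i : ℝ) = (N.factorial : ℝ) * i.factorial *
      ∑ d ∈ range (N + 1), if 2 * d ≤ N then
        (A * B) ^ d * (A + B) ^ (N - 2 * d) /
          ((N - 2 * d).factorial * (d.factorial * (d + i).factorial)) else 0 := by
  have hcoef : ∀ k ∈ range (N + 1), (N.choose k : ℝ) * ((N + 2 * i).choose (k + i) : ℝ) * A ^ k *
      B ^ (N - k) / ((N + 2 * i).choose i : ℝ) = (N.factorial : ℝ) * i.factorial *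
      ∑ d ∈ range (N + 1), if d ≤ k ∧ d ≤ N - k then A ^ k * B ^ (N - k) *
      ((1 : ℝ) / ((k - d).factorial * (N - k - d).factorial * (d.factorial * (d + i).factorial)))
      else 0 := by
    intro k hk
    rw [Finset.mem_range] at hk
    have hv := vandermonde_factorial k (N - k) i
    rw [show k + (N - k) = N by omega] at hv
    have : ∑ d ∈ range (N + 1), (if d ≤ k ∧ d ≤ N - k then A ^ k * B ^ (N - k) *
      ((1 : ℝ) / ((k - d).factorial * (N - k - d).factorial * (d.factorial * (d + i).factorial)))
      else 0) = A ^ k * B ^ (N - k) * (((N + i).factorial : ℝ) / (k.factorial * (k + i).factorial *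
        ((N - k).factorial * (N - k + i).factorial))) := by
      rw [hv, Finset.mul_sum]
      refine Finset.sum_congr rfl fun d _ => ?_
      rw [mul_ite, mul_zero]
    rw [this, Nat.cast_choose ℝ (by omega : k ≤ N),
      Nat.cast_choose ℝ (by omega : k + i ≤ N + 2 * i),
      Nat.cast_choose ℝ (by omega : i ≤ N + 2 * i), show N + 2 * i - (k + i) = N - k + i by omega,
      show N + 2 * i - i = N + i by omega]
    field_simp
  rw [ultrasphericalSum, Finset.sum_div, Finset.sum_congr rfl hcoef, ← Finset.mul_sum]
  congr 1
  rw [Finset.sum_comm]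
  refine Finset.sum_congr rfl fun d _ => ?_
  split_ifs with h
  · rw [sum_shift N d h (fun k => A ^ k * B ^ (N - k) * ((1 : ℝ) /
      ((k - d).factorial * (N - k - d).factorial * (d.factorial * (d + i).factorial)))), add_pow,
      Finset.mul_sum, Finset.sum_div]
    refine Finset.sum_congr rfl fun p hp => ?_
    rw [Finset.mem_range] at hp
    rw [Nat.cast_choose ℝ (by omega : p ≤ N - 2 * d), show p + d - d = p by omega,
      show N - (p + d) = (N - 2 * d - p) + d by omega,
      show N - 2 * d - p + d - d = N - 2 * d - p by omega]
    field_simp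
    ring
  · refine Finset.sum_eq_zero fun k hk => ?_
    rw [Finset.mem_range] at hk
    rw [if_neg (by omega)]

lemma integral_pow_mul_sin_pow (i N : ℕ) (a b : ℝ) :
    ∫ θ in (0 : ℝ)..Real.pi, (a ^ 2 + b ^ 2 + 2 * a * b * Real.cos θ) ^ N * Real.sin θ ^ (2 * i) =
      cosMoment i 0 * (ultrasphericalSum i N (a ^ 2) (b ^ 2) / ((N + 2 * i).choose i : ℝ)) := by
  have h1 : ∀ θ : ℝ, (a ^ 2 + b ^ 2 + 2 * a * b * Real.cos θ) ^ N * Real.sin θ ^ (2 * i) =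
      ∑ e ∈ range (N + 1), ((2 * a * b) ^ e * (a ^ 2 + b ^ 2) ^ (N - e) * N.choose e) *
        (Real.cos θ ^ e * Real.sin θ ^ (2 * i)) := by
    intro θ
    rw [add_comm, add_pow, Finset.sum_mul]
    refine Finset.sum_congr rfl fun e _ => ?_
    rw [mul_pow _ (Real.cos θ)]
    ring
  simp_rw [h1]
  rw [intervalIntegral.integral_finsetSum
    (fun e _ => Continuous.intervalIntegrable (by fun_prop) _ _)]
  simp_rw [intervalIntegral.integral_const_mul]
  change ∑ e ∈ range (N + 1), (2 * a * b) ^ e * (a ^ 2 + b ^ 2) ^ (N - e) * N.choose e *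
    cosMoment i e = _
  rw [sum_range_even N _ (fun d => by rw [cosMoment_odd, mul_zero]), ultrasphericalSum_eq,
    ← mul_assoc,
    Finset.mul_sum]
  refine Finset.sum_congr rfl fun d _ => ?_
  split_ifs with h
  · rw [cosMoment_even, Nat.cast_choose ℝ h, pow_mul, mul_pow (2 * a), mul_pow 2 a,
      show (2 : ℝ) ^ 2 * a ^ 2 * b ^ 2 = 4 * (a ^ 2 * b ^ 2) by ring, mul_pow 4]
    field_simp
  · simp

/-- If a polynomial is nonnegative on `[0, 1]`, then so is the associated combination of the
homogeneous polynomials `ultrasphericalSum i N`. -/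
lemma sum_coeff_ultrasphericalSum_nonneg (i : ℕ) (Q : ℝ[X])
    (hQ : ∀ w ∈ Set.Icc (0 : ℝ) 1, 0 ≤ Q.eval w)
    (M : ℕ) (hM : Q.natDegree < M) (x y : ℝ) (hx : x ∈ Set.Icc (0 : ℝ) 1)
    (hy : y ∈ Set.Icc (0 : ℝ) 1) :
    0 ≤ ∑ N ∈ range M, Q.coeff N *
      (ultrasphericalSum i N (x * y) ((1 - x) * (1 - y)) / ((N + 2 * i).choose i : ℝ)) := by
  obtain ⟨hx0, hx1⟩ := hx
  obtain ⟨hy0, hy1⟩ := hy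
  set a := √(x * y) with ha
  set b := √((1 - x) * (1 - y)) with hb
  have ha2 : a ^ 2 = x * y := Real.sq_sqrt (mul_nonneg hx0 hy0)
  have hb2 : b ^ 2 = (1 - x) * (1 - y) :=
    Real.sq_sqrt (mul_nonneg (sub_nonneg.2 hx1) (sub_nonneg.2 hy1))
  have ha0 : 0 ≤ a := Real.sqrt_nonneg _
  have hb0 : 0 ≤ b := Real.sqrt_nonneg _
  have hab : a + b ≤ 1 := by
    have h1 : a ≤ (x + y) / 2 := by
      apply abs_le_of_sq_le_sq' _ (by linarith) |>.2
      nlinarith [sq_nonneg (x - y)]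
    have h2 : b ≤ ((1 - x) + (1 - y)) / 2 := by
      apply abs_le_of_sq_le_sq' _ (by linarith) |>.2
      nlinarith [sq_nonneg (x - y)]
    linarith
  have key : ∫ θ in (0 : ℝ)..Real.pi, Q.eval (a ^ 2 + b ^ 2 + 2 * a * b * Real.cos θ) *
      Real.sin θ ^ (2 * i) = cosMoment i 0 * ∑ N ∈ range M, Q.coeff N *
      (ultrasphericalSum i N (x * y) ((1 - x) * (1 - y)) / ((N + 2 * i).choose i : ℝ)) := by
    simp_rw [eval_eq_sum_range' hM, Finset.sum_mul, mul_assoc (Q.coeff _)]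
    rw [intervalIntegral.integral_finsetSum
      (fun e _ => Continuous.intervalIntegrable (by fun_prop) _ _), Finset.mul_sum]
    refine Finset.sum_congr rfl fun N _ => ?_
    rw [intervalIntegral.integral_const_mul, integral_pow_mul_sin_pow, ha2, hb2]
    ring
  have hpos : 0 ≤ ∫ θ in (0 : ℝ)..Real.pi, Q.eval (a ^ 2 + b ^ 2 + 2 * a * b * Real.cos θ) *
      Real.sin θ ^ (2 * i) := by
    refine intervalIntegral.integral_nonneg Real.pi_pos.le fun θ _ => mul_nonneg (hQ _ ?_) ?_
    · have h1 := Real.neg_one_le_cos θ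
      have h2 := Real.cos_le_one θ
      have h3 := mul_nonneg ha0 hb0
      constructor
      · nlinarith [sq_nonneg (a - b)]
      · nlinarith
    · rw [pow_mul]; positivity
  rw [key] at hpos
  exact nonneg_of_mul_nonneg_right hpos (cosMoment_zero_pos i)
end Ultraspherical

section BernsteinSums
open Polynomial

/-- The polynomial with prescribed Bernstein coefficients. -/
def bernsteinSum (N : ℕ) (a : ℕ → ℝ) : ℝ[X] :=
  ∑ k ∈ range (N + 1), C (a k) * bernsteinPolynomial ℝ N k

lemma eval_bernsteinPolynomial (n k : ℕ) (x : ℝ) :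
    (bernsteinPolynomial ℝ n k).eval x = n.choose k * x ^ k * (1 - x) ^ (n - k) := by
  simp [bernsteinPolynomial]

lemma eval_bernsteinPolynomial_nonneg (n k : ℕ) {x : ℝ} (hx : x ∈ Set.Icc (0 : ℝ) 1) :
    0 ≤ (bernsteinPolynomial ℝ n k).eval x := by
  rw [eval_bernsteinPolynomial]
  have := hx.1
  have := sub_nonneg.2 hx.2
  positivity

lemma eval_bernsteinSum (N : ℕ) (a : ℕ → ℝ) (x : ℝ) :
    (bernsteinSum N a).eval x =
      ∑ k ∈ range (N + 1), a k * (bernsteinPolynomial ℝ N k).eval x := by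
  simp [bernsteinSum, eval_finsetSum]

lemma natDegree_bernsteinPolynomial_le (n k : ℕ) :
    (bernsteinPolynomial ℝ n k).natDegree ≤ n := by
  by_cases h : n < k
  · simp [bernsteinPolynomial.eq_zero_of_lt ℝ h]
  · rw [bernsteinPolynomial]
    have h1 : ((n.choose k : ℝ[X]) * X ^ k).natDegree ≤ k := by
      rw [← C_eq_natCast]; exact natDegree_C_mul_X_pow_le _ _
    have h2 : ((1 - X : ℝ[X]) ^ (n - k)).natDegree ≤ n - k := by
      refine natDegree_pow_le_of_le (n - k) (m := 1) ?_ |>.trans (by simp)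
      exact (natDegree_sub_le _ _).trans (by simp)
    exact natDegree_mul_le_of_le h1 h2 |>.trans (by omega)

lemma natDegree_bernsteinSum_le (N : ℕ) (a : ℕ → ℝ) : (bernsteinSum N a).natDegree ≤ N :=
  natDegree_sum_le_of_forall_le _ _ fun k _ =>
    (natDegree_C_mul_le _ _).trans (natDegree_bernsteinPolynomial_le N k)

lemma derivative_bernsteinSum_succ (N : ℕ) (a : ℕ → ℝ) :
    derivative (bernsteinSum (N + 1) a) = C ((N : ℝ) + 1) * bernsteinSum N ((fwdDiff 1) a) := by
  have h1 : ∑ k ∈ range (N + 1), C (a (k + 1)) * bernsteinPolynomial ℝ N (k + 1) +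
      C (a 0) * bernsteinPolynomial ℝ N 0 =
      ∑ k ∈ range (N + 1), C (a k) * bernsteinPolynomial ℝ N k := by
    rw [← Finset.sum_range_succ' (fun k => C (a k) * bernsteinPolynomial ℝ N k),
      Finset.sum_range_succ, bernsteinPolynomial.eq_zero_of_lt ℝ (Nat.lt_succ_self N), mul_zero,
      add_zero]
  have h2 : ∀ k, derivative (C (a (k + 1)) * bernsteinPolynomial ℝ (N + 1) (k + 1)) =
      C ((N : ℝ) + 1) * (C (a (k + 1)) * bernsteinPolynomial ℝ N k -
        C (a (k + 1)) * bernsteinPolynomial ℝ N (k + 1)) := by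
    intro k
    rw [derivative_C_mul, bernsteinPolynomial.derivative_succ]
    simp
    ring
  rw [bernsteinSum, Finset.sum_range_succ', derivative_add, derivative_sum,
    Finset.sum_congr rfl fun k _ => h2 k, ← Finset.mul_sum, Finset.sum_sub_distrib,
    derivative_C_mul, bernsteinPolynomial.derivative_zero, bernsteinSum]
  simp only [fwdDiff, C_sub, sub_mul, Finset.sum_sub_distrib]
  rw [← h1]
  simp
  ring

lemma iterate_derivative_bernsteinSum (j N : ℕ) (a : ℕ → ℝ) :
    derivative^[j] (bernsteinSum (N + j) a) =
      C (((N + j).descFactorial j : ℕ) : ℝ) * bernsteinSum N ((fwdDiff 1)^[j] a) := by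
  induction j generalizing a with
  | zero => simp
  | succ j ih =>
    rw [Function.iterate_succ_apply, ← add_assoc, derivative_bernsteinSum_succ,
      iterate_derivative_C_mul, ih, Function.iterate_succ_apply, Nat.succ_descFactorial_succ]
    push_cast
    rw [C_mul, mul_assoc]

lemma iterate_derivative_bernsteinSum_nonneg (k N : ℕ) (hk : k ≤ N) (a : ℕ → ℝ)
    (ha : ∀ v, v + k ≤ N → 0 ≤ (fwdDiff 1)^[k] a v) {x : ℝ} (hx : x ∈ Set.Icc (0 : ℝ) 1) :
    0 ≤ (derivative^[k] (bernsteinSum N a)).eval x := by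
  obtain ⟨m, rfl⟩ := Nat.exists_eq_add_of_le' hk
  rw [iterate_derivative_bernsteinSum, eval_mul, eval_C, eval_bernsteinSum]
  refine mul_nonneg (Nat.cast_nonneg _) (Finset.sum_nonneg fun v hv => mul_nonneg (ha v ?_)
    (eval_bernsteinPolynomial_nonneg _ _ hx))
  rw [Finset.mem_range] at hv
  omega

lemma fwdDiff_iter_eq_sum (k : ℕ) (g : ℝ → ℝ) (δ a : ℝ) :
    (fwdDiff δ)^[k] g a =
      ∑ i ∈ range (k + 1), (k.choose i : ℝ) * (-1) ^ (k - i) * g (a + i * δ) := by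
  rw [fwdDiff_iter_eq_sum_shift]
  refine Finset.sum_congr rfl fun i _ => ?_
  simp [mul_comm]

lemma iterate_derivative_comp_X_add_C (p : ℝ[X]) (δ : ℝ) (k : ℕ) :
    derivative^[k] (p.comp (X + C δ)) = (derivative^[k] p).comp (X + C δ) := by
  induction k with
  | zero => rfl
  | succ k ih => rw [Function.iterate_succ_apply', ih, Function.iterate_succ_apply',
      derivative_comp]; simp

lemma fwdDiff_iter_eval_nonneg (k : ℕ) (p : ℝ[X]) (δ a : ℝ) (hδ : 0 < δ)
    (hp : ∀ y ∈ Set.Icc a (a + k * δ), 0 ≤ (derivative^[k] p).eval y) :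
    0 ≤ (fwdDiff δ)^[k] (fun y => p.eval y) a := by
  induction k generalizing p with
  | zero => simpa using hp a (by simp)
  | succ k ih =>
    have h1 : (fwdDiff δ) (fun y => p.eval y) = fun y => (p.comp (X + C δ) - p).eval y := by
      ext y; simp [fwdDiff]
    rw [Function.iterate_succ_apply, h1]
    refine ih _ fun y hy => ?_
    rw [iterate_derivative_sub, iterate_derivative_comp_X_add_C, eval_sub, eval_comp, eval_add,
      eval_X, eval_C, sub_nonneg]
    have hmono : MonotoneOn (fun y => (derivative^[k] p).eval y)
        (Set.Icc a (a + (k + 1 : ℕ) * δ)) := by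
      refine monotoneOn_of_deriv_nonneg (convex_Icc _ _) (Polynomial.continuous _).continuousOn
        (Polynomial.differentiable _).differentiableOn fun z hz => ?_
      rw [Polynomial.deriv, ← Function.iterate_succ_apply' (⇑derivative)]
      exact hp z (interior_subset hz)
    obtain ⟨hy1, hy2⟩ := hy
    have hk : (0 : ℝ) ≤ k * δ := by positivity
    refine hmono ⟨hy1, ?_⟩ ⟨by linarith, ?_⟩ (by linarith) <;> push_cast <;> linarith

lemma kMono_of_iterate_derivative_nonneg (k : ℕ) (p : ℝ[X])
    (hp : ∀ y ∈ Set.Icc (0 : ℝ) 1, 0 ≤ (derivative^[k] p).eval y) :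
    kMono k (fun y => p.eval y) := by
  intro δ hδ x _
  rw [centralDiff]
  split_ifs with h
  · rw [← fwdDiff_iter_eq_sum k fun y => p.eval y]
    refine fwdDiff_iter_eval_nonneg k p δ _ hδ fun y hy => hp y ⟨h.1.1.trans hy.1, hy.2.trans ?_⟩
    have := h.2.2
    linarith
  · exact le_rfl

lemma iterate_derivative_bernsteinSum_nonneg_of_kMono (k N : ℕ) (hN : 0 < N) (hk : k ≤ N)
    (f : ℝ → ℝ) (hf : kMono k f) {x : ℝ} (hx : x ∈ Set.Icc (0 : ℝ) 1) :
    0 ≤ (derivative^[k] (bernsteinSum N fun v => f (v / N))).eval x := by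
  refine iterate_derivative_bernsteinSum_nonneg k N hk _ (fun v hv => ?_) hx
  have hN' : (0 : ℝ) < N := by exact_mod_cast hN
  have hv' : (v : ℝ) + k ≤ N := by exact_mod_cast hv
  have h0 : (0 : ℝ) ≤ v / N := by positivity
  have h1 : ((v : ℝ) + k) / N ≤ 1 := (div_le_one hN').2 hv'
  have e1 : (v + k / 2 : ℝ) / N - k * (1 / N) / 2 = v / N := by ring
  have e2 : (v + k / 2 : ℝ) / N + k * (1 / N) / 2 = (v + k) / N := by ring
  have hk0 : (0 : ℝ) ≤ k / 2 / N := by positivity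
  have e3 : (v + k / 2 : ℝ) / N = v / N + k / 2 / N := by ring
  have e4 : (v + k : ℝ) / N = v / N + k / 2 / N + k / 2 / N := by ring
  have hle : (v : ℝ) / N ≤ (v + k) / N := by rw [e4]; linarith
  have := hf (1 / N) (by positivity) ((v + k / 2) / N) (by
    rw [I01, Set.mem_Icc, e3]
    rw [e4] at h1
    constructor <;> linarith)
  rw [centralDiff, e1, e2, if_pos ⟨⟨h0, hle.trans h1⟩, ⟨h0.trans hle, h1⟩⟩] at this
  rw [fwdDiff_iter_eq_sum_shift]
  refine this.trans_eq (Finset.sum_congr rfl fun i _ => ?_)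
  simp
  ring_nf

end BernsteinSums

section DurrmeyerOperator
open Polynomial

/-- The coefficients of the genuine Bernstein-Durrmeyer operator of degree `m`. -/
def durrmeyerCoeff (f : ℝ → ℝ) (m k : ℕ) : ℝ :=
  if k = 0 then f 0 else if k = m then f 1 else
    ((m : ℝ) - 1) * ∫ y in (0 : ℝ)..1, (bernsteinPolynomial ℝ (m - 2) (k - 1)).eval y * f y

/-- The combination of genuine Bernstein-Durrmeyer operators whose weights are the coefficients
of the polynomial `H`. -/
def durrmeyerOp (H : ℝ[X]) (f : ℝ → ℝ) : ℝ[X] :=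
  H.sum fun m c => C c * bernsteinSum m (durrmeyerCoeff f m)

lemma natDegree_durrmeyerOp_le (H : ℝ[X]) (f : ℝ → ℝ) :
    (durrmeyerOp H f).natDegree ≤ H.natDegree :=
  natDegree_sum_le_of_forall_le _ _ fun m hm => (natDegree_C_mul_le _ _).trans
    ((natDegree_bernsteinSum_le m _).trans (le_natDegree_of_mem_supp m hm))

lemma durrmeyerOp_eq_sum (H : ℝ[X]) (f : ℝ → ℝ) (n : ℕ) (hn : H.natDegree < n) :
    durrmeyerOp H f =
      ∑ m ∈ range n, C (H.coeff m) * bernsteinSum m (durrmeyerCoeff f m) :=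
  sum_over_range' H (by simp) n hn

lemma eval_durrmeyerOp (H : ℝ[X]) (f : ℝ → ℝ) (n : ℕ) (hn : H.natDegree < n) (x : ℝ) :
    (durrmeyerOp H f).eval x = ∑ m ∈ range n, H.coeff m * ∑ k ∈ range (m + 1),
      durrmeyerCoeff f m k * (bernsteinPolynomial ℝ m k).eval x := by
  rw [durrmeyerOp_eq_sum H f n hn, eval_finsetSum]
  simp only [eval_mul, eval_C, eval_bernsteinSum]

lemma intervalIntegrable_eval_mul (p : ℝ[X]) {f : ℝ → ℝ} (hf : ContinuousOn f (Set.Icc 0 1)) :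
    IntervalIntegrable (fun y => p.eval y * f y) MeasureTheory.volume 0 1 := by
  refine ContinuousOn.intervalIntegrable ?_
  rw [Set.uIcc_of_le zero_le_one]
  exact p.continuous.continuousOn.mul hf

lemma durrmeyerCoeff_add {f g : ℝ → ℝ} (hf : ContinuousOn f (Set.Icc 0 1))
    (hg : ContinuousOn g (Set.Icc 0 1)) (m k : ℕ) :
    durrmeyerCoeff (fun y => f y + g y) m k = durrmeyerCoeff f m k + durrmeyerCoeff g m k := by
  unfold durrmeyerCoeff
  split_ifs
  · rfl
  · rfl
  · simp only [mul_add]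
    rw [intervalIntegral.integral_add (intervalIntegrable_eval_mul _ hf)
      (intervalIntegrable_eval_mul _ hg), mul_add]

lemma durrmeyerCoeff_const_mul (a : ℝ) (f : ℝ → ℝ) (m k : ℕ) :
    durrmeyerCoeff (fun y => a * f y) m k = a * durrmeyerCoeff f m k := by
  unfold durrmeyerCoeff
  split_ifs
  · rfl
  · rfl
  · simp only [mul_left_comm _ a]
    rw [intervalIntegral.integral_const_mul, mul_left_comm]

lemma eval_durrmeyerOp_add (H : ℝ[X]) {f g : ℝ → ℝ} (hf : ContinuousOn f (Set.Icc 0 1))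
    (hg : ContinuousOn g (Set.Icc 0 1)) (x : ℝ) :
    (durrmeyerOp H fun y => f y + g y).eval x =
      (durrmeyerOp H f).eval x + (durrmeyerOp H g).eval x := by
  simp only [eval_durrmeyerOp H _ _ (Nat.lt_succ_self _), durrmeyerCoeff_add hf hg, add_mul,
    Finset.sum_add_distrib, mul_add]

lemma eval_durrmeyerOp_const_mul (H : ℝ[X]) (a : ℝ) (f : ℝ → ℝ) (x : ℝ) :
    (durrmeyerOp H fun y => a * f y).eval x = a * (durrmeyerOp H f).eval x := by
  simp only [eval_durrmeyerOp H _ _ (Nat.lt_succ_self _), durrmeyerCoeff_const_mul, mul_assoc,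
    Finset.mul_sum, mul_left_comm _ a]

lemma integral_derivative (p : ℝ[X]) (a b : ℝ) :
    ∫ y in a..b, (derivative p).eval y = p.eval b - p.eval a :=
  intervalIntegral.integral_eq_sub_of_hasDerivAt (fun y _ => p.hasDerivAt y)
    ((derivative p).continuous.intervalIntegrable _ _)

lemma integral_mul_derivative (p q : ℝ[X]) (a b : ℝ) :
    ∫ y in a..b, p.eval y * (derivative q).eval y =
      p.eval b * q.eval b - p.eval a * q.eval a -
        ∫ y in a..b, (derivative p).eval y * q.eval y :=
  intervalIntegral.integral_mul_deriv_eq_deriv_mul (fun y _ => p.hasDerivAt y)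
    (fun y _ => q.hasDerivAt y) ((derivative p).continuous.intervalIntegrable _ _)
    ((derivative q).continuous.intervalIntegrable _ _)

lemma durrmeyerCoeff_succ_sub (p : ℝ[X]) (n k : ℕ) (hk : k ≤ n) :
    durrmeyerCoeff (fun y => p.eval y) (n + 1) (k + 1) -
      durrmeyerCoeff (fun y => p.eval y) (n + 1) k =
      ∫ y in (0 : ℝ)..1, (bernsteinPolynomial ℝ n k).eval y * (derivative p).eval y := by
  rw [integral_mul_derivative, bernsteinPolynomial.eval_at_0, bernsteinPolynomial.eval_at_1]
  have hInt : ∀ q : ℝ[X], IntervalIntegrable (fun y => q.eval y * p.eval y)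
      MeasureTheory.volume 0 1 := fun q => intervalIntegrable_eval_mul q p.continuous.continuousOn
  rcases k with _ | k
  · rw [bernsteinPolynomial.derivative_zero]
    rcases n with _ | n
    · simp [durrmeyerCoeff]
    · simp [durrmeyerCoeff, mul_assoc]
      ring
  · obtain ⟨n, rfl⟩ : ∃ n', n = n' + 1 := ⟨n - 1, by omega⟩
    rw [bernsteinPolynomial.derivative_succ]
    have h1 : ∫ y in (0 : ℝ)..1, ((((n + 1 : ℕ) : ℝ[X]) * (bernsteinPolynomial ℝ (n + 1 - 1) k -
        bernsteinPolynomial ℝ (n + 1 - 1) (k + 1))).eval y) * p.eval y =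
        (n + 1 : ℝ) * ((∫ y in (0 : ℝ)..1, (bernsteinPolynomial ℝ n k).eval y * p.eval y) -
          ∫ y in (0 : ℝ)..1, (bernsteinPolynomial ℝ n (k + 1)).eval y * p.eval y) := by
      rw [← intervalIntegral.integral_sub (hInt _) (hInt _), ← intervalIntegral.integral_const_mul]
      congr 1
      ext y
      simp
      ring
    rw [h1]
    have hk' : k ≠ n + 1 := by omega
    by_cases hkn : k = n
    · subst hkn
      simp [durrmeyerCoeff, bernsteinPolynomial.eq_zero_of_lt ℝ (Nat.lt_succ_self _)]
    · simp [durrmeyerCoeff, hkn, hk']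
      ring

lemma fwdDiff_iter_durrmeyerCoeff (p : ℝ[X]) (n i k : ℕ) (hk : k + i ≤ n) :
    (fwdDiff 1)^[i + 1] (durrmeyerCoeff (fun y => p.eval y) (n + 1)) k =
      (n.factorial : ℝ) / (n + i).factorial *
        ∫ y in (0 : ℝ)..1, (bernsteinPolynomial ℝ (n + i) (k + i)).eval y *
          (derivative^[i + 1] p).eval y := by
  induction i generalizing k with
  | zero =>
    have : (n.factorial : ℝ) ≠ 0 := by positivity
    simp only [zero_add, Function.iterate_one, fwdDiff, add_zero, div_self this, one_mul]
    exact durrmeyerCoeff_succ_sub p n k hk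
  | succ i ih =>
    rw [Function.iterate_succ_apply', fwdDiff, ih (k + 1) (by omega), ih k (by omega),
      Function.iterate_succ_apply' (⇑derivative) (i + 1), integral_mul_derivative,
      bernsteinPolynomial.eval_at_0, bernsteinPolynomial.eval_at_1, if_neg (by omega),
      if_neg (by omega), ← add_assoc k, bernsteinPolynomial.derivative_succ, ← add_assoc n]
    have hInt : ∀ q : ℝ[X], IntervalIntegrable (fun y => q.eval y * (derivative^[i + 1] p).eval y)
      MeasureTheory.volume 0 1 :=
        fun q => intervalIntegrable_eval_mul q (Polynomial.continuous _).continuousOn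
    have h1 : ∫ y in (0 : ℝ)..1, ((((n + i + 1 : ℕ) : ℝ[X]) * (bernsteinPolynomial ℝ (n + i + 1 - 1)
        (k + i) - bernsteinPolynomial ℝ (n + i + 1 - 1) (k + i + 1))).eval y) *
          (derivative^[i + 1] p).eval y = (n + i + 1 : ℝ) *
        ((∫ y in (0 : ℝ)..1, (bernsteinPolynomial ℝ (n + i) (k + i)).eval y *
          (derivative^[i + 1] p).eval y) -
          ∫ y in (0 : ℝ)..1, (bernsteinPolynomial ℝ (n + i) (k + i + 1)).eval y *
            (derivative^[i + 1] p).eval y) := by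
      rw [← intervalIntegral.integral_sub (hInt _) (hInt _), ← intervalIntegral.integral_const_mul]
      congr 1
      ext y
      simp
      ring
    rw [h1, Nat.factorial_succ, show k + 1 + i = k + i + 1 by ring]
    push_cast
    field_simp
    ring

lemma sum_bernsteinPolynomial_mul (i N : ℕ) (x y : ℝ) :
    ∑ k ∈ range (N + 1), (bernsteinPolynomial ℝ (N + 2 * i) (k + i)).eval y *
      (bernsteinPolynomial ℝ N k).eval x =
      (y * (1 - y)) ^ i * ultrasphericalSum i N (x * y) ((1 - x) * (1 - y)) := by
  rw [ultrasphericalSum, Finset.mul_sum]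
  refine Finset.sum_congr rfl fun k hk => ?_
  rw [Finset.mem_range] at hk
  rw [eval_bernsteinPolynomial, eval_bernsteinPolynomial,
    show N + 2 * i - (k + i) = N - k + i by omega, mul_pow y, mul_pow x, mul_pow (1 - x),
    pow_add, pow_add]
  ring

lemma continuous_ultrasphericalSum (i N : ℕ) (x : ℝ) :
    Continuous fun y => ultrasphericalSum i N (x * y) ((1 - x) * (1 - y)) := by
  unfold ultrasphericalSum
  fun_prop

lemma eval_iterate_derivative_durrmeyerOp (H p : ℝ[X]) (i : ℕ) (x : ℝ) :
    (derivative^[i + 1] (durrmeyerOp H fun y => p.eval y)).eval x =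
      (1 / (i.factorial : ℝ)) * ∫ y in (0 : ℝ)..1, (derivative^[i + 1] p).eval y *
        (y * (1 - y)) ^ i * ∑ N ∈ range (H.natDegree + 1), (derivative^[i + 1] H).coeff N *
          (ultrasphericalSum i N (x * y) ((1 - x) * (1 - y)) / ((N + 2 * i).choose i : ℝ)) := by
  set q := derivative^[i + 1] p with hq
  have hterm : ∀ N : ℕ, (derivative^[i + 1] (C (H.coeff (i + 1 + N)) *
      bernsteinSum (i + 1 + N) (durrmeyerCoeff (fun y => p.eval y) (i + 1 + N)))).eval x =
      (1 / (i.factorial : ℝ)) * ∫ y in (0 : ℝ)..1, (derivative^[i + 1] H).coeff N *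
        (q.eval y * (y * (1 - y)) ^ i * (ultrasphericalSum i N (x * y) ((1 - x) * (1 - y)) /
          ((N + 2 * i).choose i : ℝ))) := by
    intro N
    rw [iterate_derivative_C_mul, show i + 1 + N = N + (i + 1) by ring,
      iterate_derivative_bernsteinSum, coeff_iterate_derivative]
    simp only [eval_mul, eval_C, eval_bernsteinSum, nsmul_eq_mul]
    have h1 : ∀ k ∈ range (N + 1), (fwdDiff 1)^[i + 1]
        (durrmeyerCoeff (fun y => p.eval y) (N + (i + 1))) k *
        (bernsteinPolynomial ℝ N k).eval x = ((N + i).factorial : ℝ) / (N + 2 * i).factorial *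
        ∫ y in (0 : ℝ)..1, (bernsteinPolynomial ℝ (N + 2 * i) (k + i)).eval y * q.eval y *
          (bernsteinPolynomial ℝ N k).eval x := by
      intro k hk
      rw [Finset.mem_range] at hk
      rw [← add_assoc N, fwdDiff_iter_durrmeyerCoeff p (N + i) i k (by omega),
        intervalIntegral.integral_mul_const, show N + i + i = N + 2 * i by ring, mul_assoc]
    rw [Finset.sum_congr rfl h1, ← Finset.mul_sum, ← intervalIntegral.integral_finsetSum
      (fun k _ => Continuous.intervalIntegrable (by fun_prop) _ _)]
    have h2 : ∀ y : ℝ, ∑ k ∈ range (N + 1), (bernsteinPolynomial ℝ (N + 2 * i) (k + i)).eval y *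
        q.eval y * (bernsteinPolynomial ℝ N k).eval x = q.eval y * (y * (1 - y)) ^ i *
          ultrasphericalSum i N (x * y) ((1 - x) * (1 - y)) := by
      intro y
      rw [mul_assoc, ← sum_bernsteinPolynomial_mul, Finset.mul_sum]
      exact Finset.sum_congr rfl fun k _ => by ring
    simp only [h2, mul_div_assoc']
    rw [intervalIntegral.integral_div, intervalIntegral.integral_const_mul,
      Nat.cast_choose ℝ (by omega : i ≤ N + 2 * i), show N + 2 * i - i = N + i by omega]
    generalize ∫ y in (0 : ℝ)..1, q.eval y * (y * (1 - y)) ^ i *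
      ultrasphericalSum i N (x * y) ((1 - x) * (1 - y)) = J
    field_simp
  rw [durrmeyerOp_eq_sum H _ (i + 1 + (H.natDegree + 1)) (by omega), iterate_derivative_sum,
    eval_finsetSum, Finset.sum_range_add]
  have hzero : ∀ m ∈ range (i + 1), (derivative^[i + 1] (C (H.coeff m) *
      bernsteinSum m (durrmeyerCoeff (fun y => p.eval y) m))).eval x = 0 := by
    intro m hm
    rw [Finset.mem_range] at hm
    rw [iterate_derivative_eq_zero, eval_zero]
    exact ((natDegree_C_mul_le _ _).trans (natDegree_bernsteinSum_le _ _)).trans_lt hm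
  rw [Finset.sum_eq_zero hzero, zero_add, Finset.sum_congr rfl fun N _ => hterm N,
    ← Finset.mul_sum, ← intervalIntegral.integral_finsetSum]
  · simp only [Finset.mul_sum]
    congr 2
    ext y
    exact Finset.sum_congr rfl fun N _ => by ring
  · intro N _
    have := continuous_ultrasphericalSum i N x
    exact Continuous.intervalIntegrable (by fun_prop) _ _

lemma iterate_derivative_durrmeyerOp_nonneg (H p : ℝ[X]) (i : ℕ)
    (hH : ∀ w ∈ Set.Icc (0 : ℝ) 1, 0 ≤ (derivative^[i + 1] H).eval w)
    (hp : ∀ w ∈ Set.Icc (0 : ℝ) 1, 0 ≤ (derivative^[i + 1] p).eval w) {x : ℝ}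
    (hx : x ∈ Set.Icc (0 : ℝ) 1) :
    0 ≤ (derivative^[i + 1] (durrmeyerOp H fun y => p.eval y)).eval x := by
  rw [eval_iterate_derivative_durrmeyerOp]
  refine mul_nonneg (by positivity) (intervalIntegral.integral_nonneg zero_le_one fun y hy => ?_)
  refine mul_nonneg (mul_nonneg (hp y hy) (pow_nonneg (mul_nonneg hy.1 (sub_nonneg.2 hy.2)) _)) ?_
  exact sum_coeff_ultrasphericalSum_nonneg i _ hH _
    (((natDegree_iterate_derivative H (i + 1)).trans (Nat.sub_le _ _)).trans_lt
      (Nat.lt_succ_self _)) x y hx hy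

lemma sum_coeff_mul_eq_eval (H : ℝ[X]) (x : ℝ) (n : ℕ) (hn : H.natDegree < n) :
    ∑ m ∈ range n, H.coeff m * x ^ m = H.eval x :=
  (eval_eq_sum_range' hn x).symm

lemma sum_durrmeyerCoeff_mul (f : ℝ → ℝ) (hf : ContinuousOn f (Set.Icc 0 1)) (N : ℕ) (x : ℝ) :
    ∑ k ∈ range (N + 2 + 1), durrmeyerCoeff f (N + 2) k *
      (bernsteinPolynomial ℝ (N + 2) k).eval x =
      f 0 * (1 - x) ^ (N + 2) + f 1 * x ^ (N + 2) + x * (1 - x) * ((N + 1) *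
        ∫ y in (0 : ℝ)..1, f y * ultrasphericalSum 1 N (x * y) ((1 - x) * (1 - y))) := by
  have h1 : ∀ k ∈ range (N + 1), durrmeyerCoeff f (N + 2) (k + 1) *
      (bernsteinPolynomial ℝ (N + 2) (k + 1)).eval x = (N + 1) *
        ∫ y in (0 : ℝ)..1, ((bernsteinPolynomial ℝ N k).eval y * f y) *
          (bernsteinPolynomial ℝ (N + 2) (k + 1)).eval x := by
    intro k hk
    rw [Finset.mem_range] at hk
    rw [durrmeyerCoeff, if_neg (by omega), if_neg (by omega), intervalIntegral.integral_mul_const]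
    simp only [Nat.add_sub_cancel]
    push_cast
    ring
  have h2 : ∀ y : ℝ, ∑ k ∈ range (N + 1), ((bernsteinPolynomial ℝ N k).eval y * f y) *
      (bernsteinPolynomial ℝ (N + 2) (k + 1)).eval x = x * (1 - x) *
        (f y * ultrasphericalSum 1 N (x * y) ((1 - x) * (1 - y))) := by
    intro y
    rw [mul_left_comm, show x * y = y * x by ring, show (1 - x) * (1 - y) = (1 - y) * (1 - x) by
      ring, ← pow_one (x * (1 - x)), ← sum_bernsteinPolynomial_mul 1 N y x, Finset.mul_sum]
    exact Finset.sum_congr rfl fun k _ => by ring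
  rw [Finset.sum_range_succ, Finset.sum_range_succ', Finset.sum_congr rfl h1, ← Finset.mul_sum,
    ← intervalIntegral.integral_finsetSum
      (fun k _ => (intervalIntegrable_eval_mul _ hf).mul_const _)]
  simp only [h2]
  rw [intervalIntegral.integral_const_mul]
  simp [durrmeyerCoeff, eval_bernsteinPolynomial]
  ring

lemma eval_durrmeyerOp_eq (H : ℝ[X]) (hH : H.coeff 0 = 0) (f : ℝ → ℝ)
    (hf : ContinuousOn f (Set.Icc 0 1)) (x : ℝ) :
    (durrmeyerOp H f).eval x = f 0 * H.eval (1 - x) + f 1 * H.eval x + x * (1 - x) *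
      ∫ y in (0 : ℝ)..1, f y * ∑ N ∈ range (H.natDegree + 1), (derivative^[2] H).coeff N *
        (ultrasphericalSum 1 N (x * y) ((1 - x) * (1 - y)) / ((N + 2 * 1).choose 1 : ℝ)) := by
  have hU : ∀ N : ℕ, IntervalIntegrable
      (fun y => f y * ultrasphericalSum 1 N (x * y) ((1 - x) * (1 - y)))
      MeasureTheory.volume 0 1 := by
    intro N
    refine ContinuousOn.intervalIntegrable ?_
    rw [Set.uIcc_of_le zero_le_one]
    exact hf.mul (continuous_ultrasphericalSum 1 N x).continuousOn
  have h1 : ∫ y in (0 : ℝ)..1, f y * ∑ N ∈ range (H.natDegree + 1), (derivative^[2] H).coeff N *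
        (ultrasphericalSum 1 N (x * y) ((1 - x) * (1 - y)) / ((N + 2 * 1).choose 1 : ℝ)) =
      ∑ N ∈ range (H.natDegree + 1), H.coeff (N + 2) * ((N + 1) *
        ∫ y in (0 : ℝ)..1, f y * ultrasphericalSum 1 N (x * y) ((1 - x) * (1 - y))) := by
    simp only [← mul_assoc _ ((_ : ℝ) + 1), ← intervalIntegral.integral_const_mul]
    rw [← intervalIntegral.integral_finsetSum fun N _ => (hU N).const_mul _]
    congr 1
    ext y
    rw [Finset.mul_sum]
    refine Finset.sum_congr rfl fun N _ => ?_
    rw [coeff_iterate_derivative]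
    have : (N : ℝ) + 2 ≠ 0 := by positivity
    simp [Nat.descFactorial_succ]
    field_simp
  have hn : H.natDegree < H.natDegree + 1 + 2 := by omega
  rw [eval_durrmeyerOp H f _ hn, h1, ← sum_coeff_mul_eq_eval H x _ hn,
    ← sum_coeff_mul_eq_eval H (1 - x) _ hn]
  simp only [Finset.sum_range_succ' _ (H.natDegree + 1 + 1),
    Finset.sum_range_succ' _ (H.natDegree + 1), add_assoc, hH, zero_mul, add_zero, Nat.reduceAdd]
  have h2 := fun N => sum_durrmeyerCoeff_mul f hf N x
  simp only [add_assoc, Nat.reduceAdd] at h2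
  simp only [h2, mul_add, Finset.sum_add_distrib, Finset.mul_sum]
  simp only [Finset.sum_range_succ, durrmeyerCoeff, eval_bernsteinPolynomial]
  simp only [mul_left_comm (H.coeff _)]
  simp
  ring

lemma eval_durrmeyerOp_nonneg (H : ℝ[X]) (hH : H.coeff 0 = 0)
    (hH0 : ∀ w ∈ Set.Icc (0 : ℝ) 1, 0 ≤ H.eval w)
    (hH2 : ∀ w ∈ Set.Icc (0 : ℝ) 1, 0 ≤ (derivative^[2] H).eval w) (f : ℝ → ℝ)
    (hf : ContinuousOn f (Set.Icc 0 1)) (hf0 : ∀ y ∈ Set.Icc (0 : ℝ) 1, 0 ≤ f y) {x : ℝ}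
    (hx : x ∈ Set.Icc (0 : ℝ) 1) : 0 ≤ (durrmeyerOp H f).eval x := by
  have hx' : 1 - x ∈ Set.Icc (0 : ℝ) 1 := ⟨sub_nonneg.2 hx.2, by linarith [hx.1]⟩
  rw [eval_durrmeyerOp_eq H hH f hf]
  refine add_nonneg (add_nonneg (mul_nonneg (hf0 0 (by simp)) (hH0 _ hx'))
    (mul_nonneg (hf0 1 (by simp)) (hH0 _ hx))) (mul_nonneg (mul_nonneg hx.1 hx'.1)
      (intervalIntegral.integral_nonneg zero_le_one fun y hy => mul_nonneg (hf0 y hy) ?_))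
  exact sum_coeff_ultrasphericalSum_nonneg 1 _ hH2 _
    (((natDegree_iterate_derivative H 2).trans (Nat.sub_le _ _)).trans_lt
      (Nat.lt_succ_self _)) x y hx hy

end DurrmeyerOperator

section DurrmeyerShape
open Polynomial Filter Topology

lemma abs_eval_durrmeyerOp_sub_le (H : ℝ[X]) (hH : H.coeff 0 = 0)
    (hH0 : ∀ w ∈ Set.Icc (0 : ℝ) 1, 0 ≤ H.eval w)
    (hH2 : ∀ w ∈ Set.Icc (0 : ℝ) 1, 0 ≤ (derivative^[2] H).eval w) {f g : ℝ → ℝ}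
    (hf : ContinuousOn f (Set.Icc 0 1)) (hg : ContinuousOn g (Set.Icc 0 1)) (ε : ℝ)
    (hfg : ∀ y ∈ Set.Icc (0 : ℝ) 1, |f y - g y| ≤ ε) {x : ℝ} (hx : x ∈ Set.Icc (0 : ℝ) 1) :
    |(durrmeyerOp H f).eval x - (durrmeyerOp H g).eval x| ≤
      ε * (durrmeyerOp H fun _ => 1).eval x := by
  have key : ∀ u v : ℝ → ℝ, ContinuousOn u (Set.Icc 0 1) → ContinuousOn v (Set.Icc 0 1) →
      (∀ y ∈ Set.Icc (0 : ℝ) 1, |u y - v y| ≤ ε) →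
      (durrmeyerOp H u).eval x - (durrmeyerOp H v).eval x ≤
        ε * (durrmeyerOp H fun _ => 1).eval x := by
    intro u v hu hv huv
    have h1 : ContinuousOn (fun y => -1 * u y) (Set.Icc 0 1) := continuousOn_const.mul hu
    have h2 : ContinuousOn (fun _ : ℝ => ε * 1) (Set.Icc 0 1) := continuousOn_const
    have h3 := eval_durrmeyerOp_nonneg H hH hH0 hH2 (fun y => v y + -1 * u y + ε * 1)
      ((hv.add h1).add h2) (fun y hy => by have := (abs_le.1 (huv y hy)).2; linarith) hx
    rw [eval_durrmeyerOp_add H (f := fun y => v y + -1 * u y) (hv.add h1) h2,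
      eval_durrmeyerOp_add H hv h1,
      eval_durrmeyerOp_const_mul, eval_durrmeyerOp_const_mul H ε fun _ => 1] at h3
    linarith
  refine abs_le.2 ⟨?_, key f g hf hg hfg⟩
  have := key g f hg hf fun y hy => by rw [abs_sub_comm]; exact hfg y hy
  linarith

lemma kMono_of_tendsto (k : ℕ) (f : ℝ → ℝ) (F : ℕ → ℝ → ℝ) (hF : ∀ᶠ n in atTop, kMono k (F n))
    (hlim : ∀ x ∈ Set.Icc (0 : ℝ) 1, Tendsto (fun n => F n x) atTop (𝓝 (f x))) : kMono k f := by
  intro δ hδ x hx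
  refine ge_of_tendsto (f := fun n => centralDiff k δ (F n) x) (x := atTop) ?_
    (hF.mono fun n hn => hn δ hδ x hx)
  unfold centralDiff
  split_ifs with h
  · refine tendsto_finsetSum _ fun i hi => (hlim _ ?_).const_mul _
    have hi' : (i : ℝ) ≤ k := by exact_mod_cast Nat.lt_succ_iff.1 (Finset.mem_range.1 hi)
    have h1 := h.1.1
    have h2 := h.2.2
    have h3 : (i : ℝ) * δ ≤ k * δ := by gcongr
    have h4 : 0 ≤ (i : ℝ) * δ := by positivity
    constructor <;> linarith
  · exact tendsto_const_nhds

lemma eventually_abs_bernsteinSum_sub_le (f : ℝ → ℝ) (hf : ContinuousOn f (Set.Icc 0 1)) (ε : ℝ)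
    (hε : 0 < ε) : ∀ᶠ N : ℕ in atTop, ∀ y ∈ Set.Icc (0 : ℝ) 1,
      |(bernsteinSum N fun v => f (v / N)).eval y - f y| ≤ ε := by
  let g : C(unitInterval, ℝ) := ⟨Set.domRestrict (Set.Icc 0 1) f, hf.domRestrict⟩
  filter_upwards [Metric.tendsto_nhds.1 (bernsteinApproximation_uniform g) ε hε] with N hN y hy
  have h1 := (ContinuousMap.dist_apply_le_dist (⟨y, hy⟩ : unitInterval)).trans hN.le
  rw [Real.dist_eq, bernsteinApproximation.apply] at h1
  refine le_of_eq_of_le ?_ h1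
  congr 2
  rw [eval_bernsteinSum, Finset.sum_range]
  refine Finset.sum_congr rfl fun k _ => ?_
  rw [eval_bernsteinPolynomial, bernstein_apply, smul_eq_mul, mul_comm]
  rfl

lemma kMono_eval_durrmeyerOp (H : ℝ[X]) (hH : H.coeff 0 = 0) (k : ℕ)
    (hH' : ∀ j ≤ max k 2, ∀ w ∈ Set.Icc (0 : ℝ) 1, 0 ≤ (derivative^[j] H).eval w) {f : ℝ → ℝ}
    (hf : ContinuousOn f (Set.Icc 0 1)) (hfk : kMono k f) :
    kMono k fun y => (durrmeyerOp H f).eval y := by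
  have hH0 := hH' 0 (Nat.zero_le _)
  have hH2 := hH' 2 (le_max_right _ _)
  rcases k with _ | i
  · refine kMono_of_iterate_derivative_nonneg 0 _ fun y hy => ?_
    refine eval_durrmeyerOp_nonneg H hH hH0 hH2 f hf (fun z hz => ?_) hy
    have := hfk 1 one_pos z hz
    have hz' : z ∈ I01 := hz
    simpa [centralDiff, hz'] using this
  · set g : ℕ → ℝ[X] := fun N => bernsteinSum N fun v => f (v / N) with hg
    refine kMono_of_tendsto (i + 1) _ (fun N y => (durrmeyerOp H fun z => (g N).eval z).eval y)
      ?_ fun x hx => ?_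
    · filter_upwards [eventually_ge_atTop (i + 1)] with N hN
      exact kMono_of_iterate_derivative_nonneg _ _ fun y hy =>
        iterate_derivative_durrmeyerOp_nonneg H _ i (hH' _ (le_max_left _ _))
          (fun w hw =>
            iterate_derivative_bernsteinSum_nonneg_of_kMono _ N (by omega) hN f hfk hw) hy
    · rw [Metric.tendsto_nhds]
      intro ε hε
      set B := (durrmeyerOp H fun _ => 1).eval x with hB
      have hB0 : 0 ≤ B := eval_durrmeyerOp_nonneg H hH hH0 hH2 _ continuousOn_const
        (fun _ _ => zero_le_one) hx
      filter_upwards [eventually_abs_bernsteinSum_sub_le f hf (ε / (B + 1)) (by positivity)]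
        with N hN
      rw [Real.dist_eq]
      refine (abs_eval_durrmeyerOp_sub_le H hH hH0 hH2 (Polynomial.continuous _).continuousOn hf _
        hN hx).trans_lt ?_
      rw [← hB, div_mul_eq_mul_div, div_lt_iff₀ (by positivity)]
      nlinarith

lemma integral_bernsteinPolynomial (n k : ℕ) (hk : k ≤ n) :
    ∫ y in (0 : ℝ)..1, (bernsteinPolynomial ℝ n k).eval y = 1 / (n + 1) := by
  have hn : (n + 1 : ℝ) ≠ 0 := by positivity
  induction k with
  | zero =>
    have h := integral_derivative (bernsteinPolynomial ℝ (n + 1) 0) 0 1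
    rw [bernsteinPolynomial.derivative_zero, bernsteinPolynomial.eval_at_0,
      bernsteinPolynomial.eval_at_1] at h
    simp only [eval_mul, eval_neg, eval_natCast, Nat.add_sub_cancel] at h
    rw [intervalIntegral.integral_const_mul] at h
    simp only [if_true, (Nat.succ_ne_zero n).symm, if_false] at h
    push_cast at h
    field_simp
    linarith
  | succ k ih =>
    have h := integral_derivative (bernsteinPolynomial ℝ (n + 1) (k + 1)) 0 1
    rw [bernsteinPolynomial.derivative_succ, bernsteinPolynomial.eval_at_0,
      bernsteinPolynomial.eval_at_1, if_neg (by omega), if_neg (by omega)] at h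
    simp only [eval_mul, eval_sub, eval_natCast, Nat.add_sub_cancel] at h
    rw [intervalIntegral.integral_const_mul, intervalIntegral.integral_sub
      ((Polynomial.continuous _).intervalIntegrable _ _)
      ((Polynomial.continuous _).intervalIntegrable _ _), ih (by omega)] at h
    push_cast at h
    have := (mul_eq_zero.1 (h.trans (sub_zero _))).resolve_left hn
    linarith

lemma integral_bernsteinPolynomial_mul (n k : ℕ) (hk : k ≤ n) :
    ∫ y in (0 : ℝ)..1, (bernsteinPolynomial ℝ n k).eval y * y = (k + 1) / ((n + 1) * (n + 2)) := by
  have h1 : ∀ y : ℝ, (bernsteinPolynomial ℝ n k).eval y * y =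
      (k + 1) / (n + 1) * (bernsteinPolynomial ℝ (n + 1) (k + 1)).eval y := by
    intro y
    have h2 : ((n + 1 : ℕ) : ℝ) * n.choose k = (n + 1).choose (k + 1) * (k + 1 : ℕ) := by
      exact_mod_cast Nat.add_one_mul_choose_eq n k
    push_cast at h2
    rw [eval_bernsteinPolynomial, eval_bernsteinPolynomial, Nat.add_sub_add_right]
    have hn : (n + 1 : ℝ) ≠ 0 := by positivity
    field_simp
    linear_combination y ^ (k + 1) * (1 - y) ^ (n - k) * h2
  simp only [h1]
  rw [intervalIntegral.integral_const_mul, integral_bernsteinPolynomial _ _ (by omega)]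
  push_cast
  field_simp
  ring

lemma durrmeyerCoeff_quadratic (a b c : ℝ) (n k : ℕ) (hk : k ≤ n + 1) :
    durrmeyerCoeff (fun y => a + b * y + c * y ^ 2) (n + 1) k =
      a + b * (k / (n + 1)) + c * (k * (k + 1) / ((n + 1) * (n + 2))) := by
  induction k with
  | zero => simp [durrmeyerCoeff]
  | succ k ih =>
    have h1 : (fun y : ℝ => a + b * y + c * y ^ 2) =
        fun y => (C a + C b * X + C c * X ^ 2 : ℝ[X]).eval y := by
      ext y; simp
    have h2 := durrmeyerCoeff_succ_sub (C a + C b * X + C c * X ^ 2) n k (by omega)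
    have h3 : ∀ y : ℝ, (bernsteinPolynomial ℝ n k).eval y *
        (derivative (C a + C b * X + C c * X ^ 2 : ℝ[X])).eval y =
        b * (bernsteinPolynomial ℝ n k).eval y +
          2 * c * ((bernsteinPolynomial ℝ n k).eval y * y) := by
      intro y; simp; ring
    simp only [h3] at h2
    rw [← h1, ih (by omega), intervalIntegral.integral_add
      (Continuous.intervalIntegrable (by fun_prop) _ _)
      (Continuous.intervalIntegrable (by fun_prop) _ _), intervalIntegral.integral_const_mul,
      intervalIntegral.integral_const_mul, integral_bernsteinPolynomial _ _ (by omega),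
      integral_bernsteinPolynomial_mul _ _ (by omega)] at h2
    rw [eq_add_of_sub_eq h2]
    push_cast
    field_simp
    ring

lemma sum_durrmeyerCoeff_quadratic (a b c : ℝ) (n : ℕ) (x : ℝ) :
    ∑ k ∈ range (n + 1 + 1), durrmeyerCoeff (fun y => a + b * y + c * y ^ 2) (n + 1) k *
      (bernsteinPolynomial ℝ (n + 1) k).eval x =
      (a + b * x + c * x ^ 2) + 2 * c * (x * (1 - x)) / (n + 2) := by
  have s0 := congrArg (eval x) (bernsteinPolynomial.sum ℝ (n + 1))
  have s1 := congrArg (eval x) (bernsteinPolynomial.sum_smul ℝ (n + 1))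
  have s2 := congrArg (eval x) (bernsteinPolynomial.sum_mul_smul ℝ (n + 1))
  simp only [eval_finsetSum, eval_one, nsmul_eq_mul, eval_mul, eval_natCast, eval_X,
    eval_pow, Nat.add_sub_cancel] at s0 s1 s2
  have e : ∀ k : ℕ, ((k * (k - 1) : ℕ) : ℝ) = k * (k + 1) - 2 * k := by
    rintro (_ | k)
    · simp
    · push_cast [Nat.add_sub_cancel]; ring
  simp only [e, sub_mul, Finset.sum_sub_distrib, mul_assoc (2 : ℝ)] at s2
  rw [← Finset.mul_sum, s1] at s2
  have h : ∀ k ∈ range (n + 1 + 1),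
      durrmeyerCoeff (fun y => a + b * y + c * y ^ 2) (n + 1) k *
      (bernsteinPolynomial ℝ (n + 1) k).eval x =
      a * (bernsteinPolynomial ℝ (n + 1) k).eval x +
      b / (n + 1) * (k * (bernsteinPolynomial ℝ (n + 1) k).eval x) +
      c / ((n + 1) * (n + 2)) * (k * (k + 1) * (bernsteinPolynomial ℝ (n + 1) k).eval x) := by
    intro k hk
    rw [durrmeyerCoeff_quadratic a b c n k (by rw [Finset.mem_range] at hk; omega)]
    field_simp
  rw [Finset.sum_congr rfl h, Finset.sum_add_distrib, Finset.sum_add_distrib, ← Finset.mul_sum,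
    ← Finset.mul_sum, ← Finset.mul_sum, s0, s1, eq_add_of_sub_eq s2]
  push_cast
  field_simp
  ring

lemma eval_durrmeyerOp_quadratic (H : ℝ[X]) (hH : H.coeff 0 = 0) (hH1 : H.eval 1 = 1)
    (a b c x : ℝ) : (durrmeyerOp H fun y => a + b * y + c * y ^ 2).eval x =
      (a + b * x + c * x ^ 2) + 2 * (antideriv H).eval 1 * (c * (x * (1 - x))) := by
  have h1 : (antideriv H).eval 1 = ∑ m ∈ range (H.natDegree + 1), H.coeff m / (m + 1) := by
    rw [antideriv, sum_over_range' H (by simp) _ (Nat.lt_succ_self _), eval_finsetSum]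
    simp
  have h2 : H.eval 1 = ∑ m ∈ range (H.natDegree + 1), H.coeff m := by
    simp [eval_eq_sum_range]
  have h3 : ∀ m ∈ range (H.natDegree + 1), H.coeff m * ∑ k ∈ range (m + 1),
      durrmeyerCoeff (fun y => a + b * y + c * y ^ 2) m k * (bernsteinPolynomial ℝ m k).eval x =
      (a + b * x + c * x ^ 2) * H.coeff m + 2 * (c * (x * (1 - x))) * (H.coeff m / (m + 1)) := by
    rintro (_ | m) _
    · simp [hH]
    · rw [sum_durrmeyerCoeff_quadratic]
      push_cast
      field_simp
      ring
  rw [eval_durrmeyerOp H _ _ (Nat.lt_succ_self _), Finset.sum_congr rfl h3,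
    Finset.sum_add_distrib, ← Finset.mul_sum, ← Finset.mul_sum, ← h1, ← h2, hH1]
  ring

end DurrmeyerShape

section ErrorEstimate

lemma exists_support_line (F : ℝ → ℝ) (A x : ℝ) (hA : 0 ≤ A) (hx : x ∈ Set.Ioo (0 : ℝ) 1)
    (hF : ∀ u v w, 0 ≤ u → u < v → v < w → w ≤ 1 →
      (w - u) * F v ≤ (w - v) * F u + (v - u) * F w + A * (w - u)) :
    ∃ l : ℝ, ∀ y ∈ Set.Icc (0 : ℝ) 1, F x - A + l * (y - x) ≤ F y := by
  obtain ⟨hx0, hx1⟩ := hx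
  have key : ∀ u w, 0 ≤ u → u < x → x < w → w ≤ 1 →
      (F x - A - F u) / (x - u) ≤ (F w - F x + A) / (w - x) := by
    intro u w hu hux hxw hw
    have := hF u x w hu hux hxw hw
    rw [div_le_div_iff₀ (sub_pos.2 hux) (sub_pos.2 hxw)]
    linarith
  set S : Set ℝ := (fun u => (F x - A - F u) / (x - u)) '' Set.Ico 0 x with hS
  have hbdd : BddAbove S := by
    refine ⟨(F 1 - F x + A) / (1 - x), ?_⟩
    rintro _ ⟨u, hu, rfl⟩
    exact key u 1 hu.1 hu.2 hx1 le_rfl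
  have hne : S.Nonempty := ⟨_, 0, ⟨le_rfl, hx0⟩, rfl⟩
  refine ⟨sSup S, fun y hy => ?_⟩
  rcases lt_trichotomy y x with h | h | h
  · have h1 : (F x - A - F y) / (x - y) ≤ sSup S := le_csSup hbdd ⟨y, ⟨hy.1, h⟩, rfl⟩
    rw [div_le_iff₀ (sub_pos.2 h)] at h1
    linarith
  · subst h; linarith
  · have h1 : sSup S ≤ (F y - F x + A) / (y - x) := by
      refine csSup_le hne ?_
      rintro _ ⟨u, hu, rfl⟩
      exact key u y hu.1 hu.2 h hy.2
    rw [le_div_iff₀ (sub_pos.2 h)] at h1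
    linarith

/-- A maximum principle for functions with one-sided control of their second differences. -/
lemma le_chord_of_second_difference (F τ : ℝ → ℝ) (A : ℝ) (hA : 0 ≤ A)
    (hF : ContinuousOn F (Set.Icc 0 1)) (hτ : ∀ y ∈ Set.Ioo (0 : ℝ) 1, 0 < τ y)
    (h1 : ∀ y ∈ Set.Ioo (0 : ℝ) 1, ∀ s, 0 < s → s ≤ τ y → 0 ≤ y - s → y + s ≤ 1 →
      2 * F y - A ≤ F (y - s) + F (y + s))
    (h2 : ∀ y ∈ Set.Ioo (0 : ℝ) 1, 0 ≤ y - τ y → y + τ y ≤ 1 →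
      2 * F y < F (y - τ y) + F (y + τ y))
    (u v w : ℝ) (hu : 0 ≤ u) (huv : u < v) (hvw : v < w) (hw : w ≤ 1) :
    (w - u) * F v ≤ (w - v) * F u + (v - u) * F w + A * (w - u) := by
  have huw : 0 < w - u := by linarith
  set D : ℝ → ℝ := fun y => (w - u) * F y - ((w - y) * F u + (y - u) * F w) with hD
  have hDc : ContinuousOn D (Set.Icc u w) := by
    have := hF.mono (Set.Icc_subset_Icc hu hw)
    fun_prop
  obtain ⟨y, hy, hmax⟩ := isCompact_Icc.exists_isMaxOn (Set.nonempty_Icc.2 (huv.trans hvw).le) hDc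
  suffices D y ≤ A * (w - u) by
    have h3 : D v ≤ D y := hmax ⟨huv.le, hvw.le⟩
    simp only [hD] at h3 this
    linarith
  by_contra! hlt
  have hDu : D u = 0 := by simp only [hD]; ring
  have hDw : D w = 0 := by simp only [hD]; ring
  have hA' : 0 ≤ A * (w - u) := by positivity
  have hyu : u < y := lt_of_le_of_ne hy.1 (by rintro rfl; linarith)
  have hyw : y < w := lt_of_le_of_ne hy.2 (by rintro rfl; linarith)
  have hy01 : y ∈ Set.Ioo (0 : ℝ) 1 := ⟨by linarith, by linarith⟩
  have hτy := hτ y hy01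
  have hbig : ∀ s, 0 < s → s ≤ τ y → u ≤ y - s → y + s ≤ w →
      2 * D y - A * (w - u) ≤ D (y - s) + D (y + s) := by
    intro s hs hs1 hs2 hs3
    have := mul_le_mul_of_nonneg_left (h1 y hy01 s hs hs1 (by linarith) (by linarith)) huw.le
    simp only [hD]
    linarith
  by_cases c1 : u ≤ y - τ y ∧ y + τ y ≤ w
  · have h4 := mul_lt_mul_of_pos_left (h2 y hy01 (by linarith [c1.1]) (by linarith [c1.2])) huw
    have h5 : D (y - τ y) ≤ D y := hmax ⟨c1.1, by linarith⟩
    have h6 : D (y + τ y) ≤ D y := hmax ⟨by linarith, c1.2⟩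
    simp only [hD] at h5 h6
    linarith
  by_cases c2 : y - u ≤ w - y
  · have h7 : y - u ≤ τ y := by
      by_contra! h
      exact c1 ⟨by linarith, by linarith⟩
    have h8 := hbig (y - u) (by linarith) h7 (by linarith) (by linarith)
    have h9 : D (y + (y - u)) ≤ D y := hmax ⟨by linarith, by linarith⟩
    rw [show y - (y - u) = u by ring, hDu] at h8
    linarith
  · push Not at c2
    have h7 : w - y ≤ τ y := by
      by_contra! h
      exact c1 ⟨by linarith, by linarith⟩
    have h8 := hbig (w - y) (by linarith) h7 (by linarith) (by linarith)
    have h9 : D (y - (w - y)) ≤ D y := hmax ⟨by linarith, by linarith⟩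
    rw [show y + (w - y) = w by ring, hDw] at h8
    linarith

lemma rpow_add_rpow_le (γ r s z : ℝ) (hγ0 : 0 < γ) (hγ1 : γ ≤ 1 / 2) (hr : 0 ≤ r) (hs : 0 ≤ s)
    (hsum : r + s ≤ 2) (hmul : r * s ≤ 1 - z) :
    r ^ γ + s ^ γ ≤ 2 - γ * z / 2 := by
  have hz1 : z ≤ 1 := by nlinarith [mul_nonneg hr hs]
  have h1 : ∀ t : ℝ, 0 ≤ t → (t ^ γ) ^ 2 ≤ 1 + 2 * γ * (t - 1) := by
    intro t ht
    have := rpow_one_add_le_one_add_mul_self (s := t - 1) (p := 2 * γ) (by linarith)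
      (by linarith) (by linarith)
    rw [add_sub_cancel] at this
    refine le_of_eq_of_le ?_ this
    rw [← Real.rpow_natCast, ← Real.rpow_mul ht, mul_comm γ]
    norm_num
  have h2 : r ^ γ * s ^ γ ≤ 1 - γ * z := by
    rw [← Real.mul_rpow hr hs]
    refine (Real.rpow_le_rpow (mul_nonneg hr hs) hmul hγ0.le).trans ?_
    have := rpow_one_add_le_one_add_mul_self (s := -z) (p := γ) (by linarith)
      (by linarith) (by linarith)
    rw [← sub_eq_add_neg] at this
    linarith
  have h3 := h1 r hr
  have h4 := h1 s hs
  refine abs_le_of_sq_le_sq' (a := r ^ γ + s ^ γ) ?_ ?_ |>.2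
  · nlinarith [sq_nonneg (γ * z)]
  · nlinarith

lemma second_difference_rpow_le (γ y s : ℝ) (hγ0 : 0 < γ) (hγ1 : γ ≤ 1 / 2)
    (hy : y ∈ Set.Ioo (0 : ℝ) 1) (hs0 : 0 ≤ y - s) (hs1 : y + s ≤ 1) (hs : 0 ≤ s) :
    ((y - s) * (1 - (y - s))) ^ γ + ((y + s) * (1 - (y + s))) ^ γ ≤
      2 * (y * (1 - y)) ^ γ - γ / 8 * s ^ 2 * (y * (1 - y)) ^ (γ - 2) := by
  obtain ⟨hy0, hy1⟩ := hy
  set P := y * (1 - y) with hP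
  have hPpos : 0 < P := mul_pos hy0 (by linarith)
  have hn1 : 0 ≤ (y - s) * (1 - (y - s)) := mul_nonneg hs0 (by linarith)
  have hn2 : 0 ≤ (y + s) * (1 - (y + s)) := mul_nonneg (by linarith) (by linarith)
  have key := rpow_add_rpow_le γ ((y - s) * (1 - (y - s)) / P) ((y + s) * (1 - (y + s)) / P)
    (s ^ 2 / (4 * P ^ 2)) hγ0 hγ1 (by positivity) (by positivity) (by
      rw [← add_div, div_le_iff₀ hPpos]
      nlinarith) (by
      rw [div_mul_div_comm, div_le_iff₀ (by positivity)]
      have : (1 - s ^ 2 / (4 * P ^ 2)) * (P * P) = P ^ 2 - s ^ 2 / 4 := by field_simp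
      rw [this]
      have h2s : s ^ 2 ≤ 1 / 4 := by nlinarith
      have e : (y - s) * (1 - (y - s)) * ((y + s) * (1 - (y + s))) =
        P ^ 2 - s ^ 2 * (y ^ 2 + (1 - y) ^ 2 - s ^ 2) := by rw [hP]; ring
      have h3 : 1 / 4 ≤ y ^ 2 + (1 - y) ^ 2 - s ^ 2 := by nlinarith [sq_nonneg (2 * y - 1)]
      rw [e]
      nlinarith [mul_le_mul_of_nonneg_left h3 (sq_nonneg s)])
  rw [Real.div_rpow hn1 hPpos.le, Real.div_rpow hn2 hPpos.le, ← add_div,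
    div_le_iff₀ (by positivity)] at key
  refine key.trans_eq ?_
  have e2 : P ^ (γ - 2) = P ^ γ / P ^ 2 := by
    rw [Real.rpow_sub hPpos]; norm_num
  rw [e2]
  field_simp
  ring

lemma le_rpow_of_nonneg (γ z : ℝ) (hγ0 : 0 < γ) (hγ1 : γ ≤ 1 / 2) (hz : 0 ≤ z) :
    1 + γ * (z - 1) - (z - 1) ^ 2 ≤ z ^ γ := by
  rcases hz.eq_or_lt with rfl | hz
  · rw [Real.zero_rpow hγ0.ne']; linarith
  have h1 := rpow_one_add_le_one_add_mul_self (s := z - 1) (p := 1 - γ) (by linarith)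
    (by linarith) (by linarith)
  rw [add_sub_cancel] at h1
  have h2 : z ^ γ * z ^ (1 - γ) = z := by
    rw [← Real.rpow_add hz]; simp
  have h3 : 0 < z ^ γ := Real.rpow_pos_of_pos hz _
  have h4 : z ≤ z ^ γ * (1 + (1 - γ) * (z - 1)) := by
    calc z = z ^ γ * z ^ (1 - γ) := h2.symm
      _ ≤ _ := by gcongr
  have hD : 0 < 1 + (1 - γ) * (z - 1) := by nlinarith
  refine le_of_mul_le_mul_right (le_trans ?_ h4) hD
  have : 0 ≤ (z - 1) ^ 2 * ((1 - γ) * z + γ ^ 2) := by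
    have : 0 ≤ 1 - γ := by linarith
    positivity
  nlinarith

end ErrorEstimate

section Functional

/-- A positive linear functional on `C[0,1]` that preserves affine functions at `x` and has
second moment `σ x (1 - x)`. -/
structure IsAffinePreservingAt (Λ : (ℝ → ℝ) → ℝ) (x σ : ℝ) : Prop where
  add : ∀ f g : ℝ → ℝ, ContinuousOn f (Set.Icc 0 1) → ContinuousOn g (Set.Icc 0 1) →
    Λ (fun y => f y + g y) = Λ f + Λ g
  const_mul : ∀ (a : ℝ) (f : ℝ → ℝ), Λ (fun y => a * f y) = a * Λ f
  nonneg : ∀ f : ℝ → ℝ, ContinuousOn f (Set.Icc 0 1) → (∀ y ∈ Set.Icc (0 : ℝ) 1, 0 ≤ f y) → 0 ≤ Λ f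
  quadratic : ∀ a b c : ℝ, Λ (fun y => a + b * y + c * y ^ 2) =
    a + b * x + c * x ^ 2 + σ * (c * (x * (1 - x)))

namespace IsAffinePreservingAt

variable {Λ : (ℝ → ℝ) → ℝ} {x σ : ℝ}

lemma mono (h : IsAffinePreservingAt Λ x σ) {f g : ℝ → ℝ} (hf : ContinuousOn f (Set.Icc 0 1))
    (hg : ContinuousOn g (Set.Icc 0 1)) (hfg : ∀ y ∈ Set.Icc (0 : ℝ) 1, f y ≤ g y) :
    Λ f ≤ Λ g := by
  have hf' : ContinuousOn (fun y => -1 * f y) (Set.Icc 0 1) := continuousOn_const.mul hf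
  have h1 := h.nonneg (fun y => g y + -1 * f y) (hg.add hf') fun y hy => by
    have := hfg y hy; linarith
  rw [h.add g (fun y => -1 * f y) hg hf', h.const_mul] at h1
  linarith

lemma le_of_support_line (h : IsAffinePreservingAt Λ x σ) {F : ℝ → ℝ}
    (hF : ContinuousOn F (Set.Icc 0 1)) (a l : ℝ)
    (hl : ∀ y ∈ Set.Icc (0 : ℝ) 1, a + l * (y - x) ≤ F y) : a ≤ Λ F := by
  have h1 := h.mono (f := fun y => (a - l * x) + l * y + 0 * y ^ 2) (by fun_prop) hF fun y hy => by
    have := hl y hy; linarith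
  rw [h.quadratic] at h1
  linarith

lemma rpow_sub_le (h : IsAffinePreservingAt Λ x σ) (hx : x ∈ Set.Ioo (0 : ℝ) 1) (hσ : 0 ≤ σ)
    (γ : ℝ) (hγ0 : 0 < γ) (hγ1 : γ ≤ 1 / 2) :
    (x * (1 - x)) ^ γ - Λ (fun y => (y * (1 - y)) ^ γ) ≤ 2 * σ * (x * (1 - x)) ^ (γ - 1) := by
  obtain ⟨hx0, hx1⟩ := hx
  set P := x * (1 - x) with hP
  have hPpos : 0 < P := mul_pos hx0 (by linarith)
  have hP4 : P ≤ 1 / 4 := by nlinarith [sq_nonneg (2 * x - 1)]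
  have hc : ContinuousOn (fun y : ℝ => (y * (1 - y)) ^ γ) (Set.Icc 0 1) :=
    (Continuous.rpow_const (by fun_prop) fun _ => Or.inr hγ0.le).continuousOn
  -- the minorant `P ^ γ (1 + γ (Z - 1) - (y - x) ^ 2 / P ^ 2)` with `Z = y (1 - y) / P`
  have h1 := h.mono (f := fun y => (P ^ γ * (1 - γ - x ^ 2 / P ^ 2)) +
    (P ^ γ * (γ / P + 2 * x / P ^ 2)) * y + (P ^ γ * (-γ / P - 1 / P ^ 2)) * y ^ 2)
    (by fun_prop) hc fun y hy => by
      obtain ⟨hy0, hy1⟩ := hy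
      have hQ : 0 ≤ y * (1 - y) := mul_nonneg hy0 (by linarith)
      have h2 := le_rpow_of_nonneg γ (y * (1 - y) / P) hγ0 hγ1 (by positivity)
      rw [Real.div_rpow hQ hPpos.le, le_div_iff₀ (by positivity)] at h2
      refine le_trans ?_ h2
      have h3 : (y * (1 - y) / P - 1) ^ 2 ≤ (y - x) ^ 2 / P ^ 2 := by
        have : y * (1 - y) / P - 1 = (y - x) * (1 - x - y) / P := by
          field_simp; rw [hP]; ring
        rw [this, div_pow, mul_pow]
        gcongr
        refine mul_le_of_le_one_right (sq_nonneg _) ?_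
        nlinarith
      have h4 : P ^ γ * (1 - γ - x ^ 2 / P ^ 2) + (P ^ γ * (γ / P + 2 * x / P ^ 2)) * y +
          (P ^ γ * (-γ / P - 1 / P ^ 2)) * y ^ 2 =
          (1 + γ * (y * (1 - y) / P - 1) - (y - x) ^ 2 / P ^ 2) * P ^ γ := by ring
      rw [h4]
      gcongr
  rw [h.quadratic] at h1
  have e : P ^ (γ - 1) = P ^ γ / P := by
    rw [Real.rpow_sub hPpos, Real.rpow_one]
  have h5 : P ^ γ * (1 - γ - x ^ 2 / P ^ 2) + (P ^ γ * (γ / P + 2 * x / P ^ 2)) * x +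
      (P ^ γ * (-γ / P - 1 / P ^ 2)) * x ^ 2 +
      σ * ((P ^ γ * (-γ / P - 1 / P ^ 2)) * (x * (1 - x))) =
      P ^ γ - σ * (P ^ γ / P) * (γ * P + 1) := by
    rw [← hP]
    field_simp
    rw [hP]
    ring
  rw [h5] at h1
  rw [e]
  have h6 : σ * (P ^ γ / P) * (γ * P + 1) ≤ σ * (P ^ γ / P) * 2 := by
    gcongr
    nlinarith
  linarith

/-- The auxiliary function whose second differences dominate one at the natural step. -/
def testFunction (x h κ γ : ℝ) (y : ℝ) : ℝ :=
  (y - x) ^ 2 / h ^ 2 - κ * (y * (1 - y)) ^ γ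

lemma continuousOn_testFunction (x h κ γ : ℝ) (hγ : 0 ≤ γ) (s : Set ℝ) :
    ContinuousOn (testFunction x h κ γ) s := by
  have : Continuous fun y : ℝ => (y * (1 - y)) ^ γ :=
    Continuous.rpow_const (by fun_prop) fun _ => Or.inr hγ
  unfold testFunction
  fun_prop

lemma second_difference_testFunction (x h X γ y s : ℝ) (hh : 0 < h) (hX : 0 < X) (hγ0 : 0 < γ)
    (hγ1 : γ ≤ 1 / 2) (hy : y ∈ Set.Ioo (0 : ℝ) 1) (hs : 0 ≤ s) (hs0 : 0 ≤ y - s)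
    (hs1 : y + s ≤ 1) :
    (s / h) ^ 2 * (2 + X ^ (2 - γ) * (y * (1 - y)) ^ (γ - 2)) ≤
      testFunction x h (8 / γ * (X ^ (2 - γ) / h ^ 2)) γ (y - s) +
      testFunction x h (8 / γ * (X ^ (2 - γ) / h ^ 2)) γ (y + s) -
      2 * testFunction x h (8 / γ * (X ^ (2 - γ) / h ^ 2)) γ y := by
  have h1 := second_difference_rpow_le γ y s hγ0 hγ1 hy hs0 hs1 hs
  set κ := 8 / γ * (X ^ (2 - γ) / h ^ 2) with hκ
  have hκ0 : 0 ≤ κ := by positivity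
  have h2 := mul_le_mul_of_nonneg_left h1 hκ0
  have h3 : κ * (γ / 8 * s ^ 2 * (y * (1 - y)) ^ (γ - 2)) =
      (s / h) ^ 2 * (X ^ (2 - γ) * (y * (1 - y)) ^ (γ - 2)) := by
    rw [hκ]; field_simp
  have h4 : (y - s - x) ^ 2 / h ^ 2 + (y + s - x) ^ 2 / h ^ 2 - 2 * ((y - x) ^ 2 / h ^ 2) =
      (s / h) ^ 2 * 2 := by
    field_simp; ring
  simp only [testFunction]
  rw [mul_add, ← h3, ← h4]
  linarith

lemma one_le_second_difference_testFunction (x h X β γ y : ℝ) (hh : 0 < h) (hX : 0 < X)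
    (hβ : 0 ≤ β) (hγ0 : 0 < γ) (hγ : 2 * γ = 1 - β) (hy : y ∈ Set.Ioo (0 : ℝ) 1)
    (hs0 : 0 ≤ y - h * (y * (1 - y) / X) ^ β) (hs1 : y + h * (y * (1 - y) / X) ^ β ≤ 1) :
    1 ≤ testFunction x h (8 / γ * (X ^ (2 - γ) / h ^ 2)) γ (y - h * (y * (1 - y) / X) ^ β) +
      testFunction x h (8 / γ * (X ^ (2 - γ) / h ^ 2)) γ (y + h * (y * (1 - y) / X) ^ β) -
      2 * testFunction x h (8 / γ * (X ^ (2 - γ) / h ^ 2)) γ y := by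
  have hP : 0 < y * (1 - y) := mul_pos hy.1 (by linarith [hy.2])
  set P := y * (1 - y)
  refine le_trans ?_ (second_difference_testFunction x h X γ y _ hh hX hγ0 (by linarith) hy
    (by positivity) hs0 hs1)
  rw [mul_div_cancel_left₀ _ hh.ne']
  have e1 : X ^ (2 - γ) * P ^ (γ - 2) = (P / X) ^ (γ - 2) := by
    rw [Real.div_rpow hP.le hX.le, show γ - 2 = -(2 - γ) by ring, Real.rpow_neg hX.le]
    field_simp
  have e2 : ((P / X) ^ β) ^ 2 * (P / X) ^ (γ - 2) = (P / X) ^ (-(3 * γ)) := by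
    rw [← Real.rpow_natCast, ← Real.rpow_mul (by positivity), ← Real.rpow_add (by positivity)]
    congr 1
    push_cast
    linarith
  have hp : 0 < P / X := by positivity
  rw [e1, mul_add, e2]
  rcases le_total 1 (P / X) with h1 | h1
  · have h2 : 1 ≤ (P / X) ^ β := Real.one_le_rpow h1 hβ
    have h3 : 0 < (P / X) ^ (-(3 * γ)) := Real.rpow_pos_of_pos hp _
    nlinarith
  · have h2 : 1 ≤ (P / X) ^ (-(3 * γ)) :=
      Real.one_le_rpow_of_pos_of_le_one_of_nonpos hp h1 (by linarith)
    nlinarith [sq_nonneg ((P / X) ^ β)]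

lemma testFunction_sub_le (hΛ : IsAffinePreservingAt Λ x σ) (hx : x ∈ Set.Ioo (0 : ℝ) 1)
    (hσ : 0 ≤ σ) (K h γ : ℝ) (hh : 0 < h) (hσh : σ * (x * (1 - x)) ≤ K * h ^ 2) (hγ0 : 0 < γ)
    (hγ1 : γ ≤ 1 / 2) :
    Λ (testFunction x h (8 / γ * ((x * (1 - x) + h) ^ (2 - γ) / h ^ 2)) γ) -
      testFunction x h (8 / γ * ((x * (1 - x) + h) ^ (2 - γ) / h ^ 2)) γ x ≤
        K + 64 * K / γ + 32 / γ := by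
  have hP : 0 < x * (1 - x) := mul_pos hx.1 (by linarith [hx.2])
  set P := x * (1 - x) with hPdef
  set X := P + h with hX
  have hXpos : 0 < X := by positivity
  have hK : 0 ≤ K := by
    by_contra! hK
    have : K * h ^ 2 < 0 := mul_neg_of_neg_of_pos hK (by positivity)
    have : 0 ≤ σ * P := by positivity
    linarith
  set κ := 8 / γ * (X ^ (2 - γ) / h ^ 2) with hκ
  have hκ0 : 0 ≤ κ := by positivity
  have hc : Continuous fun y : ℝ => (y * (1 - y)) ^ γ :=
    Continuous.rpow_const (by fun_prop) fun _ => Or.inr hγ0.le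
  have e1 : Λ (testFunction x h κ γ) =
      σ * P / h ^ 2 - κ * Λ fun y => (y * (1 - y)) ^ γ := by
    have : testFunction x h κ γ = fun y => (x ^ 2 / h ^ 2 + (-2 * x / h ^ 2) * y +
        (1 / h ^ 2) * y ^ 2) + (-κ) * (y * (1 - y)) ^ γ := by
      ext y; simp only [testFunction]; ring
    rw [this, hΛ.add (fun y => x ^ 2 / h ^ 2 + (-2 * x / h ^ 2) * y + (1 / h ^ 2) * y ^ 2)
      (fun y => -κ * (y * (1 - y)) ^ γ)
      (by fun_prop) (continuous_const.mul hc).continuousOn, hΛ.quadratic, hΛ.const_mul, ← hPdef]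
    ring
  have e2 : testFunction x h κ γ x = -(κ * P ^ γ) := by
    simp [testFunction, hPdef]
  have h1 : σ * P / h ^ 2 ≤ K := by rwa [div_le_iff₀ (by positivity)]
  have h2 : κ * (P ^ γ - Λ fun y => (y * (1 - y)) ^ γ) ≤ 64 * K / γ + 32 / γ := by
    have two_pow : (2 : ℝ) ^ (2 - γ) ≤ 4 := by
      calc (2 : ℝ) ^ (2 - γ) ≤ 2 ^ (2 : ℝ) :=
            Real.rpow_le_rpow_of_exponent_le (by norm_num) (by linarith)
        _ = 4 := by norm_num
    rcases le_total h P with hhP | hhP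
    · have h3 := hΛ.rpow_sub_le hx hσ γ hγ0 hγ1
      rw [← hPdef] at h3
      have h4 : X ^ (2 - γ) ≤ 4 * P ^ (2 - γ) := by
        calc X ^ (2 - γ) ≤ (2 * P) ^ (2 - γ) :=
              Real.rpow_le_rpow hXpos.le (by linarith) (by linarith)
          _ = 2 ^ (2 - γ) * P ^ (2 - γ) := Real.mul_rpow (by norm_num) hP.le
          _ ≤ _ := by gcongr
      have h5 : P ^ (2 - γ) * P ^ (γ - 1) = P := by
        rw [← Real.rpow_add hP]
        norm_num
      calc κ * (P ^ γ - Λ fun y => (y * (1 - y)) ^ γ) ≤ κ * (2 * σ * P ^ (γ - 1)) := by gcongr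
        _ ≤ 8 / γ * (4 * P ^ (2 - γ) / h ^ 2) * (2 * σ * P ^ (γ - 1)) := by
          rw [hκ]; gcongr
        _ = 64 / γ * (σ * (P ^ (2 - γ) * P ^ (γ - 1)) / h ^ 2) := by ring
        _ ≤ 64 / γ * K := by rw [h5]; gcongr
        _ ≤ 64 * K / γ + 32 / γ := by
          have : 0 ≤ 32 / γ := by positivity
          rw [div_mul_eq_mul_div]; linarith
    · have h3 : 0 ≤ Λ fun y => (y * (1 - y)) ^ γ := hΛ.nonneg _ hc.continuousOn fun y hy =>
        Real.rpow_nonneg (mul_nonneg hy.1 (by linarith [hy.2])) _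
      have h4 : X ^ (2 - γ) ≤ 4 * h ^ (2 - γ) := by
        calc X ^ (2 - γ) ≤ (2 * h) ^ (2 - γ) :=
              Real.rpow_le_rpow hXpos.le (by linarith) (by linarith)
          _ = 2 ^ (2 - γ) * h ^ (2 - γ) := Real.mul_rpow (by norm_num) hh.le
          _ ≤ _ := by gcongr
      have h5 : h ^ (2 - γ) * h ^ γ = h ^ 2 := by
        rw [← Real.rpow_add hh]
        norm_num
      calc κ * (P ^ γ - Λ fun y => (y * (1 - y)) ^ γ) ≤ κ * h ^ γ := by
            gcongr
            have : P ^ γ ≤ h ^ γ := Real.rpow_le_rpow hP.le hhP hγ0.le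
            linarith
        _ ≤ 8 / γ * (4 * h ^ (2 - γ) / h ^ 2) * h ^ γ := by rw [hκ]; gcongr
        _ = 32 / γ * ((h ^ (2 - γ) * h ^ γ) / h ^ 2) := by ring
        _ = 32 / γ := by rw [h5, div_self (by positivity), mul_one]
        _ ≤ 64 * K / γ + 32 / γ := by
          have : 0 ≤ 64 * K / γ := by positivity
          linarith
  rw [e1, e2]
  linarith

lemma sub_le_of_second_difference (hΛ : IsAffinePreservingAt Λ x σ) (hx : x ∈ Set.Ioo (0 : ℝ) 1)
    (hσ : 0 ≤ σ) (K h β A : ℝ) (hh : 0 < h) (hσh : σ * (x * (1 - x)) ≤ K * h ^ 2)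
    (hβ0 : 0 ≤ β) (hβ1 : β < 1) (hA : 0 ≤ A) {f : ℝ → ℝ} (hf : ContinuousOn f (Set.Icc 0 1))
    (hfA : ∀ y ∈ Set.Ioo (0 : ℝ) 1, ∀ s, 0 < s →
      s ≤ h * (y * (1 - y) / (x * (1 - x) + h)) ^ β → 0 ≤ y - s → y + s ≤ 1 →
        2 * f y - A ≤ f (y - s) + f (y + s)) :
    f x - Λ f ≤ (1 + K + 64 * K / ((1 - β) / 2) + 32 / ((1 - β) / 2)) * A := by
  set γ := (1 - β) / 2 with hγ
  have hγ0 : 0 < γ := by rw [hγ]; linarith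
  have hγ1 : γ ≤ 1 / 2 := by rw [hγ]; linarith
  have hP : 0 < x * (1 - x) := mul_pos hx.1 (by linarith [hx.2])
  have hE := hΛ.testFunction_sub_le hx hσ K h γ hh hσh hγ0 hγ1
  have hXpos : 0 < x * (1 - x) + h := by positivity
  have hdiff := second_difference_testFunction x h _ γ (hh := hh) (hX := hXpos) (hγ0 := hγ0)
    (hγ1 := hγ1)
  have hdiff1 := one_le_second_difference_testFunction x h _ β γ (hh := hh) (hX := hXpos)
    (hβ := hβ0) (hγ0 := hγ0) (hγ := by rw [hγ]; ring)
  set X := x * (1 - x) + h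
  set G := testFunction x h (8 / γ * (X ^ (2 - γ) / h ^ 2)) γ with hG
  have hGc : ContinuousOn G (Set.Icc 0 1) := continuousOn_testFunction _ _ _ _ hγ0.le _
  have key : ∀ B, A < B → f x - Λ f ≤ (1 + K + 64 * K / γ + 32 / γ) * B := by
    intro B hAB
    have hB : 0 < B := hA.trans_lt hAB
    have hBG : ContinuousOn (fun y => B * G y) (Set.Icc 0 1) := continuousOn_const.mul hGc
    have hFc : ContinuousOn (fun y => f y + B * G y) (Set.Icc 0 1) := hf.add hBG
    obtain ⟨l, hl⟩ := exists_support_line (fun y => f y + B * G y) B x hB.le hx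
      (le_chord_of_second_difference _ (fun y => h * (y * (1 - y) / X) ^ β) B hB.le hFc
        (fun y hy => by
          have : 0 < y * (1 - y) := mul_pos hy.1 (by linarith [hy.2])
          positivity)
        (fun y hy s hs hs1 hs2 hs3 => by
          have h1 := hfA y hy s hs hs1 hs2 hs3
          have h2 := hdiff y s hy hs.le hs2 hs3
          have hPy : 0 < y * (1 - y) := mul_pos hy.1 (by linarith [hy.2])
          have h3 := mul_nonneg hB.le (le_trans (by positivity) h2)
          linarith)
        (fun y hy hs2 hs3 => by
          have hPy : 0 < y * (1 - y) := mul_pos hy.1 (by linarith [hy.2])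
          have h1 := hfA y hy _ (by positivity) le_rfl hs2 hs3
          have h2 := mul_le_mul_of_nonneg_left (hdiff1 y hy hs2 hs3) hB.le
          linarith))
    have h3 := hΛ.le_of_support_line hFc _ l hl
    rw [hΛ.add f (fun y => B * G y) hf hBG, hΛ.const_mul] at h3
    have h4 := mul_le_mul_of_nonneg_left hE hB.le
    linarith
  set c := 1 + K + 64 * K / γ + 32 / γ
  have hlim : Filter.Tendsto (fun B => c * B) (nhdsWithin A (Set.Ioi A)) (nhds (c * A)) :=
    ((continuous_const.mul continuous_id).tendsto A).mono_left nhdsWithin_le_nhds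
  exact ge_of_tendsto hlim (eventually_nhdsWithin_of_forall fun B hB => key B hB)

end IsAffinePreservingAt

end Functional

section Modulus

lemma centralDiff_two (δ : ℝ) (f : ℝ → ℝ) (x : ℝ) (h0 : 0 ≤ x - δ) (h1 : x + δ ≤ 1)
    (hδ : 0 ≤ δ) : centralDiff 2 δ f x = f (x - δ) - 2 * f x + f (x + δ) := by
  have e1 : x - (2 : ℕ) * δ / 2 = x - δ := by push_cast; ring
  have e2 : x + (2 : ℕ) * δ / 2 = x + δ := by push_cast; ring
  have e4 : x - δ + 2 * δ = x + δ := by ring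
  rw [centralDiff, e1, e2, if_pos ⟨⟨h0, by linarith⟩, ⟨by linarith, h1⟩⟩]
  simp [Finset.sum_range_succ, e4]
  ring

lemma abs_centralDiff_two_le (δ : ℝ) (f : ℝ → ℝ) (B x : ℝ) (hx : x ∈ I01)
    (hf : ∀ y ∈ I01, |f y| ≤ B) : |centralDiff 2 δ f x| ≤ 4 * B := by
  have hB : 0 ≤ B := (abs_nonneg _).trans (hf x hx)
  have e1 : x - (2 : ℕ) * δ / 2 = x - δ := by push_cast; ring
  have e2 : x + (2 : ℕ) * δ / 2 = x + δ := by push_cast; ring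
  have e3 : x - δ + 1 * δ = x := by ring
  have e4 : x - δ + 2 * δ = x + δ := by ring
  rw [centralDiff, e1, e2]
  split_ifs with h
  · have h1 := abs_le.1 (hf _ h.1)
    have h2 := abs_le.1 (hf _ h.2)
    have h3 := abs_le.1 (hf _ hx)
    simp only [Finset.sum_range_succ, Finset.sum_range_zero]
    norm_num [e3, e4]
    rw [abs_le]
    constructor <;> linarith
  · simpa using hB

variable {ψ f : ℝ → ℝ}

lemma bddAbove_omega2_set (hf : ContinuousOn f I01) (t : ℝ) :
    BddAbove {v : ℝ | ∃ s x : ℝ, 0 < s ∧ s ≤ t ∧ x ∈ I01 ∧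
      v = |centralDiff 2 (s * ψ x) f x|} := by
  obtain ⟨B, hB⟩ := isCompact_Icc.exists_bound_of_continuousOn hf
  refine ⟨4 * B, ?_⟩
  rintro v ⟨s, x, -, -, hx, rfl⟩
  exact abs_centralDiff_two_le _ f B x hx hB

lemma omega2_nonneg (ψ f : ℝ → ℝ) (t : ℝ) : 0 ≤ omega2 ψ f t := by
  refine Real.sSup_nonneg ?_
  rintro v ⟨s, x, -, -, -, rfl⟩
  exact abs_nonneg _

lemma omega2_mono (hf : ContinuousOn f I01) {t₁ t₂ : ℝ} (ht : t₁ ≤ t₂) :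
    omega2 ψ f t₁ ≤ omega2 ψ f t₂ := by
  refine Real.sSup_le ?_ (omega2_nonneg ψ f t₂)
  rintro v ⟨s, x, hs, hst, hx, rfl⟩
  exact le_csSup (bddAbove_omega2_set hf t₂) ⟨s, x, hs, hst.trans ht, hx, rfl⟩

lemma abs_second_difference_le_omega2 (hf : ContinuousOn f I01) {t s y : ℝ} (hψ : 0 < ψ y)
    (hs : 0 < s) (hst : s ≤ t * ψ y) (h0 : 0 ≤ y - s) (h1 : y + s ≤ 1) :
    |f (y - s) - 2 * f y + f (y + s)| ≤ omega2 ψ f t := by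
  refine le_csSup (bddAbove_omega2_set hf t) ⟨s / ψ y, y, by positivity, ?_, ?_, ?_⟩
  · rwa [div_le_iff₀ hψ]
  · exact ⟨by linarith, by linarith⟩
  · rw [div_mul_cancel₀ _ hψ.ne', centralDiff_two s f y h0 h1 hs.le]

lemma phi_sq {x : ℝ} (hx : x ∈ I01) : phi x ^ 2 = x * (1 - x) :=
  Real.sq_sqrt (mul_nonneg hx.1 (by linarith [hx.2]))

lemma phi_nonneg (x : ℝ) : 0 ≤ phi x := Real.sqrt_nonneg _

lemma phi_pos {x : ℝ} (hx : x ∈ Set.Ioo (0 : ℝ) 1) : 0 < phi x :=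
  Real.sqrt_pos.2 (mul_pos hx.1 (by linarith [hx.2]))

lemma step_eq {x y n lam : ℝ} (hx : x ∈ Set.Ioo (0 : ℝ) 1) (hy : y ∈ Set.Ioo (0 : ℝ) 1)
    (hn : 0 < n) :
    phi x / n * (y * (1 - y) / (x * (1 - x) + phi x / n)) ^ (lam / 2) =
      n⁻¹ * phi x ^ (1 - lam / 2) * (phi x + 1 / n) ^ (-(lam / 2)) * phi y ^ lam := by
  have hx0 := phi_pos hx
  have hy0 := phi_pos hy
  have e1 : x * (1 - x) + phi x / n = phi x * (phi x + 1 / n) := by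
    rw [← phi_sq (Set.Ioo_subset_Icc_self hx)]; ring
  have e2 : (y * (1 - y)) ^ (lam / 2) = phi y ^ lam := by
    rw [← phi_sq (Set.Ioo_subset_Icc_self hy), ← Real.rpow_natCast, ← Real.rpow_mul hy0.le]
    congr 1
    push_cast
    ring
  rw [e1, Real.div_rpow (mul_nonneg hy.1.le (by linarith [hy.2])) (by positivity), e2,
    Real.mul_rpow hx0.le (by positivity), Real.rpow_sub hx0, Real.rpow_one,
    Real.rpow_neg (by positivity)]
  field_simp

end Modulus

section Approximation

open Polynomial

lemma isAffinePreservingAt_durrmeyerOp (H : ℝ[X]) (hH : H.coeff 0 = 0) (hH1 : H.eval 1 = 1)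
    (hH0 : ∀ w ∈ Set.Icc (0 : ℝ) 1, 0 ≤ H.eval w)
    (hH2 : ∀ w ∈ Set.Icc (0 : ℝ) 1, 0 ≤ (derivative^[2] H).eval w) {x : ℝ}
    (hx : x ∈ Set.Icc (0 : ℝ) 1) :
    IsAffinePreservingAt (fun f => (durrmeyerOp H f).eval x) x (2 * (antideriv H).eval 1) where
  add _ _ hf hg := eval_durrmeyerOp_add H hf hg x
  const_mul a f := eval_durrmeyerOp_const_mul H a f x
  nonneg f hf hf0 := eval_durrmeyerOp_nonneg H hH hH0 hH2 f hf hf0 hx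
  quadratic a b c := eval_durrmeyerOp_quadratic H hH hH1 a b c x

lemma eval_antideriv_one_nonneg (H : ℝ[X]) (hH : H.coeff 0 = 0) (hH1 : H.eval 1 = 1)
    (hH0 : ∀ w ∈ Set.Icc (0 : ℝ) 1, 0 ≤ H.eval w)
    (hH2 : ∀ w ∈ Set.Icc (0 : ℝ) 1, 0 ≤ (derivative^[2] H).eval w) :
    0 ≤ (antideriv H).eval 1 := by
  have h := (isAffinePreservingAt_durrmeyerOp H hH hH1 hH0 hH2 (x := 1 / 2)
    (by constructor <;> norm_num)).mono
    (f := fun y => 0 + 0 * y + 0 * y ^ 2) (g := fun y => 1 / 4 + (-1) * y + 1 * y ^ 2)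
    (by fun_prop) (by fun_prop) (fun y _ => by nlinarith [sq_nonneg (y - 1 / 2)])
  simp only [eval_durrmeyerOp_quadratic H hH hH1] at h
  linarith

/-- The constant in the pointwise estimate for weight exponent `lam`. -/
def errorConst (K lam : ℝ) : ℝ :=
  1 + 2 * K + 64 * (2 * K) / ((1 - lam / 2) / 2) + 32 / ((1 - lam / 2) / 2)

lemma errorConst_pos {K lam : ℝ} (hK : 0 < K) (hlam : lam < 2) : 0 < errorConst K lam := by
  have : 0 < 1 - lam / 2 := by linarith
  unfold errorConst
  positivity

lemma abs_sub_eval_durrmeyerOp_le (H : ℝ[X]) (hH : H.coeff 0 = 0) (hH1 : H.eval 1 = 1)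
    (hH0 : ∀ w ∈ Set.Icc (0 : ℝ) 1, 0 ≤ H.eval w)
    (hH2 : ∀ w ∈ Set.Icc (0 : ℝ) 1, 0 ≤ (derivative^[2] H).eval w) {K n : ℝ} (hK : 0 < K)
    (hn : 0 < n) (hHK : (antideriv H).eval 1 ≤ K / n ^ 2) {lam : ℝ}
    (hlam : lam ∈ Set.Ico (0 : ℝ) 2) {f : ℝ → ℝ} (hf : ContinuousOn f I01) {x : ℝ}
    (hx : x ∈ I01) :
    |f x - (durrmeyerOp H f).eval x| ≤ errorConst K lam * omega2 (fun y => phi y ^ lam) f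
      (n⁻¹ * phi x ^ (1 - lam / 2) * (phi x + 1 / n) ^ (-(lam / 2))) := by
  set A := omega2 (fun y => phi y ^ lam) f
    (n⁻¹ * phi x ^ (1 - lam / 2) * (phi x + 1 / n) ^ (-(lam / 2))) with hA
  have hA0 : 0 ≤ A := omega2_nonneg _ _ _
  have hzero : H.eval 0 = 0 := by rw [← coeff_zero_eq_eval_zero, hH]
  rcases eq_or_ne x 0 with rfl | hx0
  · rw [eval_durrmeyerOp_eq H hH f hf]
    simpa [hzero, hH1] using mul_nonneg (errorConst_pos hK hlam.2).le hA0
  rcases eq_or_ne x 1 with rfl | hx1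
  · rw [eval_durrmeyerOp_eq H hH f hf]
    simpa [hzero, hH1] using mul_nonneg (errorConst_pos hK hlam.2).le hA0
  have hxo : x ∈ Set.Ioo (0 : ℝ) 1 := ⟨lt_of_le_of_ne hx.1 hx0.symm, lt_of_le_of_ne hx.2 hx1⟩
  have hΛ := isAffinePreservingAt_durrmeyerOp H hH hH1 hH0 hH2 hx
  have hσ : 0 ≤ 2 * (antideriv H).eval 1 := by
    linarith [eval_antideriv_one_nonneg H hH hH1 hH0 hH2]
  have hφ := phi_pos hxo
  have hσh : 2 * (antideriv H).eval 1 * (x * (1 - x)) ≤ 2 * K * (phi x / n) ^ 2 := by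
    rw [← phi_sq hx]
    calc 2 * (antideriv H).eval 1 * phi x ^ 2 ≤ 2 * (K / n ^ 2) * phi x ^ 2 := by gcongr
      _ = 2 * K * (phi x / n) ^ 2 := by ring
  have hdiff : ∀ y ∈ Set.Ioo (0 : ℝ) 1, ∀ s, 0 < s →
      s ≤ phi x / n * (y * (1 - y) / (x * (1 - x) + phi x / n)) ^ (lam / 2) → 0 ≤ y - s →
        y + s ≤ 1 → |f (y - s) - 2 * f y + f (y + s)| ≤ A := by
    intro y hy s hs hst h0 h1
    rw [step_eq hxo hy hn] at hst
    exact abs_second_difference_le_omega2 hf (Real.rpow_pos_of_pos (phi_pos hy) _) hs hst h0 h1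
  have hlam2 : lam / 2 < 1 := by linarith [hlam.2]
  have h1 := hΛ.sub_le_of_second_difference hxo hσ (2 * K) (phi x / n) (lam / 2) A
    (by positivity) hσh (by linarith [hlam.1]) hlam2 hA0 hf fun y hy s hs hst h0 h1 => by
      linarith [(abs_le.1 (hdiff y hy s hs hst h0 h1)).1]
  have h2 := hΛ.sub_le_of_second_difference hxo hσ (2 * K) (phi x / n) (lam / 2) A
    (by positivity) hσh (by linarith [hlam.1]) hlam2 hA0
    (f := fun y => -1 * f y) (continuousOn_const.mul hf) fun y hy s hs hst h0 h1 => by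
      linarith [(abs_le.1 (hdiff y hy s hs hst h0 h1)).2]
  rw [hΛ.const_mul] at h2
  rw [abs_le]
  unfold errorConst
  constructor <;> linarith

end Approximation

theorem statement1 (q : ℕ) :
    ∃ c : ℝ → ℝ,
      (∀ lam ∈ Set.Ico (0 : ℝ) 2, 0 < c lam) ∧
      ∀ n : ℕ, 1 ≤ n →
        ∃ M : (ℝ → ℝ) → (ℝ → ℝ),
          PositiveLinearOp M ∧
          (∀ f, ContinuousOn f I01 → IsPolyOfDegLe n (M f)) ∧
          (∀ k ≤ q, ∀ f, ContinuousOn f I01 → kMono k f → kMono k (M f)) ∧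
          (∀ lam ∈ Set.Ico (0 : ℝ) 2,
            ∀ f, ContinuousOn f I01 → ∀ x ∈ I01,
              |f x - M f x| ≤
                c lam * omega2 (fun y => phi y ^ lam) f
                  ((n : ℝ)⁻¹ * phi x ^ ((1 : ℝ) - lam / 2) *
                    (phi x + 1 / (n : ℝ)) ^ (-(lam / 2)))) ∧
          (∀ f, ContinuousOn f I01 → ∀ x ∈ I01,
              |f x - M f x| ≤
                c 0 * omega2 (fun _ => 1) f (Real.sqrt (x * (1 - x)) / (n : ℝ))) ∧
          (∀ f, ContinuousOn f I01 → ∀ x ∈ I01,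
              |f x - M f x| ≤
                  c 1 * omega2 phi f ((n : ℝ)⁻¹ * Real.sqrt (phi x / (phi x + 1 / (n : ℝ)))) ∧
              |f x - M f x| ≤ c 1 * omega2 phi f ((n : ℝ)⁻¹)) := by
  obtain ⟨K, hK, hKn⟩ := exists_absolutelyMonotone_polynomial (q + 1)
  refine ⟨errorConst K, fun lam hlam => errorConst_pos hK hlam.2, fun n hn => ?_⟩
  obtain ⟨H, hdeg, hH, hH1, hHd, hHK⟩ := hKn n hn
  have hn0 : (0 : ℝ) < n := by exact_mod_cast hn
  have hH0 := hHd 0 (by omega)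
  have hH2 := hHd 2 (by omega)
  have herr : ∀ lam ∈ Set.Ico (0 : ℝ) 2, ∀ f, ContinuousOn f I01 → ∀ x ∈ I01,
      |f x - (durrmeyerOp H f).eval x| ≤ errorConst K lam * omega2 (fun y => phi y ^ lam) f
        ((n : ℝ)⁻¹ * phi x ^ (1 - lam / 2) * (phi x + 1 / (n : ℝ)) ^ (-(lam / 2))) :=
    fun lam hlam f hf x hx =>
      abs_sub_eval_durrmeyerOp_le H hH hH1 hH0 hH2 hK hn0 hHK hlam hf hx
  have herr1 : ∀ f, ContinuousOn f I01 → ∀ x ∈ I01, |f x - (durrmeyerOp H f).eval x| ≤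
      errorConst K 1 * omega2 phi f
        ((n : ℝ)⁻¹ * Real.sqrt (phi x / (phi x + 1 / (n : ℝ)))) := by
    intro f hf x hx
    have h := herr 1 ⟨by norm_num, by norm_num⟩ f hf x hx
    have hφ := phi_nonneg x
    have e : (n : ℝ)⁻¹ * phi x ^ ((1 : ℝ) - 1 / 2) * (phi x + 1 / (n : ℝ)) ^ (-(1 / 2 : ℝ)) =
        (n : ℝ)⁻¹ * Real.sqrt (phi x / (phi x + 1 / (n : ℝ))) := by
      rw [Real.sqrt_div hφ, Real.rpow_neg (by positivity), Real.sqrt_eq_rpow, Real.sqrt_eq_rpow]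
      norm_num
      ring
    simpa only [e, Real.rpow_one] using h
  refine ⟨fun f x => (durrmeyerOp H f).eval x, ⟨?_, ?_, ?_, ?_⟩, ?_, ?_, herr, ?_, ?_⟩
  · exact fun f g hf hg x _ => eval_durrmeyerOp_add H hf hg x
  · exact fun a f _ x _ => eval_durrmeyerOp_const_mul H a f x
  · exact fun f _ => (durrmeyerOp H f).continuous.continuousOn
  · exact fun f hf hf0 x hx => eval_durrmeyerOp_nonneg H hH hH0 hH2 f hf hf0 hx
  · exact fun f _ => ⟨durrmeyerOp H f, (natDegree_durrmeyerOp_le H f).trans hdeg, fun _ => rfl⟩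
  · exact fun k hk f hf hfk =>
      kMono_eval_durrmeyerOp H hH k (fun j hj => hHd j (by omega)) hf hfk
  · intro f hf x hx
    have h := herr 0 ⟨le_rfl, by norm_num⟩ f hf x hx
    have e : (n : ℝ)⁻¹ * phi x = Real.sqrt (x * (1 - x)) / n := by rw [phi]; ring
    simpa [e] using h
  · refine fun f hf x hx => ⟨herr1 f hf x hx, (herr1 f hf x hx).trans ?_⟩
    have hφ := phi_nonneg x
    refine mul_le_mul_of_nonneg_left (omega2_mono hf ?_) (errorConst_pos hK (by norm_num)).le
    refine mul_le_of_le_one_right (by positivity) (Real.sqrt_le_one.2 ?_)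
    exact div_le_one_of_le₀ (by simp) (by positivity)
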